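/- arXiv:2302.02673 — 2 statements merged into one kernel-verified Lean document; each statement's English description precedes it below -/
import Mathlib

section
/- Let μ > 0 and for each integer N ≥ 1 set ℏ = ℏ_N := μ/N. Then for every test function φ in the class 𝒜, the limit lim_{N→∞} ∬_{ℝ²} [σ_{P_{<N}}^{ℏ_N}(x,p) − χ_D(x,p)] φ(x,p) dx dp = 0 holds. -/
open MeasureTheory Filter

/-- Physicists' Hermite polynomial `h_k(y) = (-1)^k e^{y^2} (d/dy)^k e^{-y^2}`. -/
noncomputable def hermiteH (k : ℕ) (y : ℝ) : ℝ :=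
  (-1)^k * Real.exp (y^2) * iteratedDeriv k (fun t => Real.exp (-t^2)) y

/-- Hermite function `ψ_k^ℏ`. -/
noncomputable def psiH (hbar : ℝ) (k : ℕ) (x : ℝ) : ℝ :=
  (Real.sqrt (Real.sqrt Real.pi * 2^k * (Nat.factorial k) * Real.sqrt hbar))⁻¹ *
    Real.exp (-x^2 / (2*hbar)) * hermiteH k (x / Real.sqrt hbar)

/-- Kernel of the spectral projection `P_{<N}`. -/
noncomputable def KerK (hbar : ℝ) (N : ℕ) (u v : ℝ) : ℝ :=
  ∑ k ∈ Finset.range N, psiH hbar k u * psiH hbar k v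

/-- Kernel of the Zeno Hamiltonian `H_N = P_{<N} p̂ P_{<N}`. -/
noncomputable def KerQ (hbar : ℝ) (N : ℕ) (u v : ℝ) : ℂ :=
  Complex.I * (Real.sqrt (hbar/2) : ℂ) *
    ∑ j ∈ Finset.range (N-1), ((Real.sqrt ((j:ℝ)+1) : ℝ) : ℂ) *
      ((psiH hbar (j+1) u * psiH hbar j v - psiH hbar j u * psiH hbar (j+1) v : ℝ) : ℂ)

/-- Weyl symbol of `P_{<N}`. -/
noncomputable def sigmaP (hbar : ℝ) (N : ℕ) (x p : ℝ) : ℂ :=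
  ∫ y : ℝ, ((hbar * KerK hbar N (x - hbar*y/2) (x + hbar*y/2) : ℝ) : ℂ) *
    Complex.exp (Complex.I * (p:ℂ) * (y:ℂ))

/-- Weyl symbol of `H_N`. -/
noncomputable def sigmaH (hbar : ℝ) (N : ℕ) (x p : ℝ) : ℂ :=
  ∫ y : ℝ, (hbar : ℂ) * KerQ hbar N (x - hbar*y/2) (x + hbar*y/2) *
    Complex.exp (Complex.I * (p:ℂ) * (y:ℂ))

namespace WC
open Polynomial

/-- Unnormalised generalised Laguerre polynomials `j! L_j^{(m)}`. -/
noncomputable def lagM : ℕ → ℕ → ℝ[X]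
  | 0, _ => 1
  | j + 1, m => C ((j : ℝ) + 1 + m) * lagM j m - X * lagM j (m + 1)

lemma lagM_coeff (j : ℕ) : ∀ m l : ℕ, (lagM j m).coeff l =
    (-1) ^ l * (j.choose l : ℝ) * ((j + m).factorial / (l + m).factorial) := by
  induction j with
  | zero =>
    intro m l
    rcases l with _ | l
    · simp [lagM]
      rw [div_self (by positivity)]
    · simp [lagM, coeff_one]
  | succ j ih =>
    intro m l
    rcases l with _ | l
    · simp only [lagM, coeff_sub, coeff_C_mul, ih, coeff_X_mul_zero]
      rw [show j + 1 + m = (j + m) + 1 by ring, Nat.factorial_succ]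
      push_cast
      simp
      ring
    · simp only [lagM, coeff_sub, coeff_C_mul, ih, coeff_X_mul]
      rw [show j + 1 + m = (j + m) + 1 by ring, show l + (m + 1) = l + 1 + m by ring,
        show j + (m + 1) = j + m + 1 by ring,
        Nat.factorial_succ (j + m), Nat.choose_succ_succ]
      push_cast
      ring

/-- Laguerre polynomials. -/
noncomputable def lag (k : ℕ) : ℝ[X] := C ((k.factorial : ℝ)⁻¹) * lagM k 0

lemma lag_coeff (k l : ℕ) : (lag k).coeff l = (-1) ^ l * (k.choose l : ℝ) / l.factorial := by
  rw [lag, coeff_C_mul, lagM_coeff]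
  have : (k.factorial : ℝ) ≠ 0 := by positivity
  simp
  field_simp

lemma lag_natDegree (k : ℕ) : (lag k).natDegree < k + 1 := by
  rw [Nat.lt_succ_iff, natDegree_le_iff_coeff_eq_zero]
  intro l hl
  rw [lag_coeff, Nat.choose_eq_zero_of_lt hl]; simp

lemma lag_rec (k : ℕ) : X * lag (k + 1) =
    C (2 * (k : ℝ) + 3) * lag (k + 1) - C ((k : ℝ) + 2) * lag (k + 2) - C ((k : ℝ) + 1) * lag k := by
  ext l
  rcases l with _ | l
  · simp [lag_coeff]; ring
  · simp only [coeff_X_mul, coeff_sub, coeff_C_mul, lag_coeff]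
    have h1 : ((k + 2).choose (l + 1) : ℝ) = (k+1).choose l + (k+1).choose (l+1) := by
      rw [Nat.choose_succ_succ]; push_cast; ring
    have h2 : ((k + 1).choose (l + 1) : ℝ) = k.choose l + k.choose (l+1) := by
      rw [Nat.choose_succ_succ]; push_cast; ring
    have h3 : ((k:ℝ) + 1) * k.choose l = (k + 1 - l) * (k+1).choose l := by
      rcases le_or_gt l (k+1) with h | h
      · have := Nat.choose_mul_succ_eq k l
        have h' : ((k.choose l * (k+1) : ℕ) : ℝ) = (((k+1).choose l * (k + 1 - l) : ℕ) : ℝ) := by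
          rw [this]
        push_cast [Nat.cast_sub h] at h'
        linarith
      · rw [Nat.choose_eq_zero_of_lt h, Nat.choose_eq_zero_of_lt (by omega)]; simp
    rw [Nat.factorial_succ, h1]
    have hl : (l.factorial : ℝ) ≠ 0 := by positivity
    push_cast
    have hl1 : (l:ℝ) + 1 ≠ 0 := by positivity
    field_simp
    rw [pow_succ]
    have h4 : (k.choose (l+1) : ℝ) = (k+1).choose (l+1) - k.choose l := by linarith
    rw [h4]
    linear_combination (-1)^l * h3

lemma lag_rec_zero : X * lag 0 = lag 0 - lag 1 := by
  ext l
  rcases l with _ | _ | l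
  · simp [lag_coeff]
  · simp [lag_coeff]
  · simp [lag_coeff, coeff_X_mul, Nat.choose_eq_zero_of_lt]

open Set in
lemma pow_exp_integrable (a : ℝ) (ha : 0 < a) (n : ℕ) :
    IntegrableOn (fun s : ℝ => s ^ n * Real.exp (-(a * s))) (Ioi 0) := by
  have := integrableOn_rpow_mul_exp_neg_mul_rpow (p := 1) (s := n) (b := a)
    (by have : (0:ℝ) ≤ n := by positivity
        linarith) one_pos ha
  simpa using this

open Set in
lemma pow_exp_integral (a : ℝ) (ha : 0 < a) (n : ℕ) :
    ∫ s in Ioi (0:ℝ), s ^ n * Real.exp (-(a * s)) = n.factorial / a ^ (n + 1) := by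
  have := Real.integral_rpow_mul_exp_neg_mul_Ioi (a := n + 1) (r := a) (by positivity) ha
  simp only [add_sub_cancel_right, Real.rpow_natCast] at this
  rw [this, Real.Gamma_nat_eq_factorial]
  have h : (1 / a) ^ ((n:ℝ) + 1) = (1 / a) ^ (n + 1) := by
    rw [← Real.rpow_natCast]; push_cast; rfl
  rw [h]
  rw [div_pow, one_pow]; ring

open Set in
lemma poly_exp_integrable (a : ℝ) (ha : 0 < a) (q : ℝ[X]) :
    IntegrableOn (fun s : ℝ => q.eval s * Real.exp (-(a * s))) (Ioi 0) := by
  simp_rw [eval_eq_sum_range, Finset.sum_mul, mul_assoc]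
  exact integrable_finsetSum _ fun i _ => (pow_exp_integrable a ha i).const_mul _

/-- Laplace functional at `1` -/
noncomputable def E (q : ℝ[X]) : ℝ := ∫ s in Set.Ioi (0:ℝ), q.eval s * Real.exp (-(1 * s))

lemma E_add (p q : ℝ[X]) : E (p + q) = E p + E q := by
  simp only [E, eval_add, add_mul]
  exact integral_add (poly_exp_integrable 1 one_pos p) (poly_exp_integrable 1 one_pos q)

lemma E_C_mul (c : ℝ) (q : ℝ[X]) : E (C c * q) = c * E q := by
  simp only [E, eval_mul, eval_C, mul_assoc]
  exact integral_const_mul _ _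

/-- `E` as a linear map. -/
noncomputable def El : ℝ[X] →ₗ[ℝ] ℝ where
  toFun := E
  map_add' := E_add
  map_smul' c q := by rw [smul_eq_C_mul, E_C_mul]; rfl

lemma El_C_mul (c : ℝ) (q : ℝ[X]) : El (C c * q) = c * El q := E_C_mul c q

lemma El_X_pow (n : ℕ) : El (X ^ n) = n.factorial := by
  have := pow_exp_integral 1 one_pos n
  simpa [El, E] using this

lemma El_lagM (j : ℕ) : ∀ m n : ℕ, El (lagM j m * X ^ (m + n)) =
    (-1) ^ j * (m + n).factorial * n.descFactorial j := by
  induction j with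
  | zero => intro m n; simp [lagM, El_X_pow]
  | succ j ih =>
    intro m n
    have : lagM (j+1) m * X ^ (m + n) = C ((j : ℝ) + 1 + m) * (lagM j m * X ^ (m + n))
        - lagM j (m + 1) * X ^ (m + 1 + n) := by
      rw [lagM]; ring
    rw [this, map_sub, El_C_mul, ih, ih, Nat.descFactorial_succ]
    rw [show m + 1 + n = m + n + 1 by ring, Nat.factorial_succ]
    rcases le_or_gt j n with h | h
    · push_cast [Nat.cast_sub h]; ring
    · rw [Nat.descFactorial_of_lt h]; simp

lemma El_lag (k n : ℕ) : El (lag k * X ^ n) = (-1) ^ k * n.factorial * n.choose k := by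
  have h := El_lagM k 0 n
  rw [zero_add, Nat.descFactorial_eq_factorial_mul_choose] at h
  have : (k.factorial : ℝ) ≠ 0 := by positivity
  rw [lag, mul_assoc, El_C_mul, h]
  push_cast
  field_simp

lemma El_lag_lag_le {j k : ℕ} (h : j ≤ k) : El (lag k * lag j) = if j = k then 1 else 0 := by
  rw [(lag j).as_sum_range' (j+1) (lag_natDegree j), Finset.mul_sum, map_sum]
  have : ∀ l ∈ Finset.range (j+1), El (lag k * monomial l ((lag j).coeff l)) =
      if l = k then (if j = k then 1 else 0) else 0 := by
    intro l hl
    rw [← C_mul_X_pow_eq_monomial, mul_left_comm, El_C_mul, El_lag, lag_coeff]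
    rw [Finset.mem_range] at hl
    split_ifs with h1 h2
    · subst h1
      obtain rfl : j = l := h2
      have : (j.factorial : ℝ) ≠ 0 := by positivity
      simp
      field_simp
      rw [← pow_mul]; simp
    · omega
    · rw [Nat.choose_eq_zero_of_lt (show l < k by omega)]; simp
  rw [Finset.sum_congr rfl this]
  rw [Finset.sum_ite_eq']
  split_ifs with h1 h2 h2 <;> simp at * <;> omega

lemma El_lag_lag (j k : ℕ) : El (lag k * lag j) = if j = k then 1 else 0 := by
  rcases le_total j k with h | h
  · exact El_lag_lag_le h
  · rw [mul_comm, El_lag_lag_le h]; simp only [eq_comm]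

lemma El_sq_sum (s : Finset ℕ) (c : ℕ → ℝ) (f : ℕ → ℕ) (hf : Set.InjOn f s) :
    El ((∑ k ∈ s, C (c k) * lag (f k)) ^ 2) = ∑ k ∈ s, c k ^ 2 := by
  rw [sq, Finset.sum_mul_sum, map_sum]
  refine Finset.sum_congr rfl fun i hi => ?_
  rw [map_sum, Finset.sum_eq_single i]
  · rw [mul_mul_mul_comm, ← C_mul, El_C_mul, El_lag_lag]; simp [sq]
  · intro j hj hji
    rw [mul_mul_mul_comm, ← C_mul, El_C_mul, El_lag_lag, if_neg, mul_zero]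
    exact fun h => hji (hf hj hi h)
  · exact fun h => absurd hi h

lemma El_mono {p q : ℝ[X]} (h : ∀ s, p.eval s ≤ q.eval s) : El p ≤ El q := by
  refine integral_mono (poly_exp_integrable 1 one_pos p) (poly_exp_integrable 1 one_pos q) ?_
  intro s
  exact mul_le_mul_of_nonneg_right (h s) (Real.exp_pos _).le

/-- The alternating Laguerre sum. -/
noncomputable def G (N : ℕ) : ℝ[X] := ∑ k ∈ Finset.range N, C ((-1) ^ k) * lag k

lemma El_G_sq (N : ℕ) : El (G N ^ 2) = N := by
  rw [G, El_sq_sum _ _ (fun k => k) (fun _ _ _ _ h => h)]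
  simp [← pow_mul]

lemma lag_rec' (k : ℕ) : X * lag k =
    C (2 * (k : ℝ) + 1) * lag k - C ((k : ℝ) + 1) * lag (k + 1) - C (k : ℝ) * lag (k - 1) := by
  rcases k with _ | k
  · rw [lag_rec_zero]; simp
  · rw [lag_rec]; simp only [Nat.cast_add, Nat.cast_one, Nat.add_sub_cancel]
    rw [show 2 * ((k:ℝ) + 1) + 1 = 2 * k + 3 by ring, show (k:ℝ) + 1 + 1 = k + 2 by ring]

lemma El_XG_sq (N : ℕ) : El ((X * G N) ^ 2) ≤ 18 * N ^ 3 := by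
  have key : X * G N = (∑ k ∈ Finset.range N, C ((-1) ^ k * (2 * (k:ℝ) + 1)) * lag k)
      - (∑ k ∈ Finset.range N, C ((-1) ^ k * ((k:ℝ) + 1)) * lag (k + 1))
      - (∑ k ∈ (Finset.range N).filter (0 < ·), C ((-1) ^ k * (k:ℝ)) * lag (k - 1)) := by
    rw [Finset.sum_filter_of_ne, ← Finset.sum_sub_distrib, ← Finset.sum_sub_distrib, G,
      Finset.mul_sum]
    · refine Finset.sum_congr rfl fun k _ => ?_
      rw [mul_left_comm, lag_rec']; simp only [C_mul]; ring
    · intro k _ hk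
      rcases k with _ | k
      · simp at hk
      · simp
  rw [key]
  set A := (∑ k ∈ Finset.range N, C ((-1) ^ k * (2 * (k:ℝ) + 1)) * lag k) with hA
  set B := (∑ k ∈ Finset.range N, C ((-1) ^ k * ((k:ℝ) + 1)) * lag (k + 1)) with hB
  set D := (∑ k ∈ (Finset.range N).filter (0 < ·), C ((-1) ^ k * (k:ℝ)) * lag (k - 1)) with hD
  have h1 : El ((A - B - D) ^ 2) ≤ El (C 3 * A ^ 2 + C 3 * B ^ 2 + C 3 * D ^ 2) := by
    apply El_mono
    intro s
    simp only [eval_pow, eval_sub, eval_add, eval_mul, eval_C]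
    nlinarith [sq_nonneg (eval s A + eval s B), sq_nonneg (eval s A + eval s D),
      sq_nonneg (eval s B - eval s D)]
  refine h1.trans ?_
  simp only [map_add, El_C_mul]
  rw [hA, hB, hD, El_sq_sum _ _ (fun k => k) (fun _ _ _ _ h => h),
    El_sq_sum _ _ (fun k => k + 1) (fun _ _ _ _ h => by simpa using h),
    El_sq_sum _ _ (fun k => k - 1) (fun a ha b hb h => by
      simp at ha hb h; omega)]
  have e1 : ∑ k ∈ Finset.range N, ((-1) ^ k * (2 * (k:ℝ) + 1)) ^ 2 ≤ (N:ℝ) * (4 * (N:ℝ) ^ 2) := by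
    rw [← nsmul_eq_mul]
    have := Finset.sum_le_card_nsmul (Finset.range N)
      (fun k : ℕ => ((-1) ^ k * (2 * (k:ℝ) + 1)) ^ 2) (4 * (N:ℝ) ^ 2) (by
        intro k hk
        have hk' : (k:ℝ) + 1 ≤ N := by exact_mod_cast Finset.mem_range.1 hk
        have : (0:ℝ) ≤ k := by positivity
        have hs : ((-1:ℝ) ^ k) ^ 2 = 1 := by rw [← pow_mul, mul_comm, pow_mul]; simp
        simp only [mul_pow, hs]
        nlinarith)
    simpa using this
  have e2 : ∑ k ∈ Finset.range N, ((-1) ^ k * ((k:ℝ) + 1)) ^ 2 ≤ (N:ℝ) * ((N:ℝ) ^ 2) := by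
    rw [← nsmul_eq_mul]
    have := Finset.sum_le_card_nsmul (Finset.range N)
      (fun k : ℕ => ((-1) ^ k * ((k:ℝ) + 1)) ^ 2) ((N:ℝ) ^ 2) (by
        intro k hk
        have hk' : (k:ℝ) + 1 ≤ N := by exact_mod_cast Finset.mem_range.1 hk
        have : (0:ℝ) ≤ k := by positivity
        have hs : ((-1:ℝ) ^ k) ^ 2 = 1 := by rw [← pow_mul, mul_comm, pow_mul]; simp
        simp only [mul_pow, hs]
        nlinarith)
    simpa using this
  have e3 : ∑ k ∈ (Finset.range N).filter (0 < ·), ((-1) ^ k * (k:ℝ)) ^ 2 ≤ (N:ℝ) * ((N:ℝ) ^ 2) := by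
    refine le_trans (Finset.sum_le_sum_of_subset_of_nonneg (Finset.filter_subset _ _)
      (fun _ _ _ => sq_nonneg _)) (le_trans (Finset.sum_le_sum ?_) e2)
    intro k _
    have : (0:ℝ) ≤ k := by positivity
    have hs : ((-1:ℝ) ^ k) ^ 2 = 1 := by rw [← pow_mul, mul_comm, pow_mul]; simp
    simp only [mul_pow, hs]
    nlinarith
  nlinarith

lemma lag_laplace (a : ℝ) (ha : 0 < a) (k : ℕ) :
    ∫ s in Set.Ioi (0:ℝ), (lag k).eval s * Real.exp (-(a * s)) = (1 / a) * (1 - 1 / a) ^ k := by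
  simp_rw [eval_eq_sum_range' (lag_natDegree k), Finset.sum_mul, mul_assoc]
  rw [integral_finsetSum _ fun i _ => (pow_exp_integrable a ha i).const_mul _]
  simp_rw [integral_const_mul, pow_exp_integral a ha, lag_coeff]
  rw [sub_eq_neg_add, add_pow, Finset.mul_sum]
  refine Finset.sum_congr rfl fun l _ => ?_
  have : (l.factorial : ℝ) ≠ 0 := by positivity
  have ha' := ha.ne'
  rw [neg_pow (1/a), div_pow]
  simp
  field_simp
  ring

/-- Physicists' Hermite polynomials. -/
noncomputable def herm : ℕ → ℝ[X]
  | 0 => 1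
  | k + 1 => C 2 * X * herm k - derivative (herm k)

lemma herm_deriv (k : ℕ) : derivative (herm (k + 1)) = C (2 * ((k:ℝ) + 1)) * herm k := by
  induction k with
  | zero => simp [herm]
  | succ k ih =>
    rw [herm, derivative_sub, ih]
    simp only [derivative_mul, derivative_C, derivative_X, ih, zero_mul, zero_add, mul_one]
    have : herm (k+1) = C 2 * X * herm k - derivative (herm k) := rfl
    have h2 : C 2 * X * (C (2 * ((k:ℝ) + 1)) * herm k) -  C (2 * ((k:ℝ) + 1)) * derivative (herm k)
      = C (2 * ((k:ℝ) + 1)) * herm (k+1) := by rw [this]; ring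
    rw [add_sub_assoc, h2, ← add_mul, ← C_add]
    congr 2; push_cast; ring

lemma iteratedDeriv_gauss (k : ℕ) : iteratedDeriv k (fun t : ℝ => Real.exp (-t^2)) =
    fun t => (-1) ^ k * (herm k).eval t * Real.exp (-t^2) := by
  induction k with
  | zero => ext t; simp [herm]
  | succ k ih =>
    rw [iteratedDeriv_succ, ih]
    ext t
    have h1 : HasDerivAt (fun t : ℝ => Real.exp (-t^2)) (Real.exp (-t^2) * (-(2 * t))) t := by
      have : HasDerivAt (fun t : ℝ => -t^2) (-(2 * t)) t := by
        refine (hasDerivAt_pow 2 t).neg.congr_deriv ?_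
        simp
      exact this.exp
    have h2 := (((herm k).hasDerivAt t).const_mul ((-1) ^ k)).mul h1
    refine h2.deriv.trans ?_
    simp only [herm, eval_sub, eval_mul, eval_C, eval_X, pow_succ]
    ring

lemma hermiteH_eq (k : ℕ) (y : ℝ) : hermiteH k y = (herm k).eval y := by
  rw [hermiteH, iteratedDeriv_gauss]
  have h : Real.exp (y^2) * Real.exp (-y^2) = 1 := by rw [← Real.exp_add]; simp
  have h' : ((-1:ℝ)^k) * (-1)^k = 1 := by rw [← mul_pow]; simp
  calc _ = ((-1)^k * (-1)^k) * (Real.exp (y^2) * Real.exp (-y^2)) * (herm k).eval y := by ring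
    _ = _ := by rw [h, h']; ring

/-- the oscillating gaussian -/
noncomputable def osc (P : ℝ) (t : ℝ) : ℂ := Complex.exp (-(t:ℂ)^2 + 2 * (Complex.I * P) * t)

lemma poly_osc_integrable (P : ℝ) (q : ℝ[X]) :
    Integrable (fun t : ℝ => ((q.eval t : ℝ) : ℂ) * osc P t) := by
  have h1 : Integrable (fun t : ℝ => q.eval t * Real.exp (-t^2)) := by
    simp_rw [eval_eq_sum_range, Finset.sum_mul, mul_assoc]
    refine integrable_finsetSum _ fun i _ => ?_
    have := integrable_rpow_mul_exp_neg_mul_sq (b := 1) one_pos (s := i)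
      (by have : (0:ℝ) ≤ i := by positivity
          linarith)
    simpa using this.const_mul _
  refine h1.norm.mono' (Continuous.aestronglyMeasurable ?_) (ae_of_all _ fun t => ?_)
  · unfold osc; fun_prop
  · rw [norm_mul, norm_mul, osc, Complex.norm_exp]
    simp [← Complex.ofReal_pow]

/-- Oscillating Gaussian functional. -/
noncomputable def J (P : ℝ) (q : ℝ[X]) : ℂ := ∫ t : ℝ, ((q.eval t : ℝ) : ℂ) * osc P t

lemma J_add (P : ℝ) (p q : ℝ[X]) : J P (p + q) = J P p + J P q := by
  simp only [J, eval_add, Complex.ofReal_add, add_mul]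
  exact integral_add (poly_osc_integrable P p) (poly_osc_integrable P q)

lemma J_C_mul (P : ℝ) (c : ℝ) (q : ℝ[X]) : J P (C c * q) = c * J P q := by
  simp only [J, eval_mul, eval_C, Complex.ofReal_mul, mul_assoc]
  exact integral_const_mul _ _

lemma J_sub (P : ℝ) (p q : ℝ[X]) : J P (p - q) = J P p - J P q := by
  simp only [J, eval_sub, Complex.ofReal_sub, sub_mul]
  exact integral_sub (poly_osc_integrable P p) (poly_osc_integrable P q)

lemma J_ibp (P : ℝ) (q : ℝ[X]) :
    J P (C 2 * X * q) = J P (derivative q) + 2 * (Complex.I * P) * J P q := by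
  have hosc : ∀ t : ℝ, HasDerivAt (osc P) (osc P t * (-(2 * t) + 2 * (Complex.I * P))) t := by
    intro t
    have h1 : HasDerivAt (fun t : ℝ => (t : ℂ)) 1 t := Complex.ofRealCLM.hasDerivAt
    have h2 : HasDerivAt (fun t : ℝ => -(t:ℂ)^2 + 2 * (Complex.I * P) * t)
        (-(2 * t) + 2 * (Complex.I * P)) t := by
      refine ((h1.pow 2).neg.add (h1.const_mul (2 * (Complex.I * P)))).congr_deriv ?_
      simp
    exact h2.cexp
  have hq : ∀ t : ℝ, HasDerivAt (fun t : ℝ => ((q.eval t : ℝ) : ℂ))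
      (((derivative q).eval t : ℝ) : ℂ) t := fun t => (q.hasDerivAt t).ofReal_comp
  have hd : ∀ t : ℝ, HasDerivAt (fun t : ℝ => ((q.eval t : ℝ) : ℂ) * osc P t)
      ((((derivative q).eval t : ℝ) : ℂ) * osc P t - (((C 2 * X * q).eval t : ℝ) : ℂ) * osc P t
        + 2 * (Complex.I * P) * (((q.eval t : ℝ) : ℂ) * osc P t)) t := by
    intro t
    refine ((hq t).mul (hosc t)).congr_deriv ?_
    simp only [eval_mul, eval_C, eval_X]; push_cast; ring
  have i1 := poly_osc_integrable P (derivative q)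
  have i2 := poly_osc_integrable P (C 2 * X * q)
  have i3 := (poly_osc_integrable P q).const_mul (2 * (Complex.I * P))
  have := integral_eq_zero_of_hasDerivAt_of_integrable hd ((i1.sub i2).add i3)
    (poly_osc_integrable P q)
  have h2 := integral_add (i1.sub i2) i3
  simp only [Pi.sub_apply] at h2
  rw [h2, integral_sub i1 i2, integral_const_mul] at this
  simp only [J]
  linear_combination -this

lemma J_one (P : ℝ) : J P 1 = (Real.sqrt Real.pi * Real.exp (-P^2) : ℝ) := by
  have := integral_cexp_quadratic (b := -1) (by simp) (2 * (Complex.I * P)) 0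
  simp only [J, osc, eval_one, Complex.ofReal_one, one_mul]
  simp only [add_zero] at this
  convert this using 1
  · simp
  · push_cast
    rw [Real.sqrt_eq_rpow, Complex.ofReal_cpow Real.pi_pos.le]
    congr 1
    · simp
    · congr 1
      linear_combination -(P:ℂ)^2 * Complex.I_sq

/-- The product polynomial. -/
noncomputable def HH (x : ℝ) (j k : ℕ) : ℝ[X] :=
  (herm j).comp (C x - X) * (herm k).comp (C x + X)

lemma HH_deriv (x : ℝ) (j k : ℕ) : derivative (HH x j k) =
    (herm j).comp (C x - X) * (derivative (herm k)).comp (C x + X)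
    - (derivative (herm j)).comp (C x - X) * (herm k).comp (C x + X) := by
  simp only [HH, derivative_mul, derivative_comp, derivative_sub, derivative_add, derivative_C,
    derivative_X]
  ring

lemma HH_right (x P : ℝ) (k : ℕ) :
    J P (HH x 0 (k+1)) = 2 * (x + Complex.I * P) * J P (HH x 0 k) := by
  have e : HH x 0 (k+1) = C (2 * x) * HH x 0 k + C 2 * X * HH x 0 k - derivative (HH x 0 k) := by
    rw [HH_deriv]
    simp [HH, herm]
    ring
  rw [e, J_sub, J_add, J_C_mul, J_ibp]; push_cast; ring

lemma HH_left (x P : ℝ) (j k : ℕ) :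
    J P (HH x (j+1) (k+1)) = 2 * (x - Complex.I * P) * J P (HH x j (k+1))
      - 2 * (k + 1) * J P (HH x j k) := by
  have e : HH x (j+1) (k+1) = C (2 * x) * HH x j (k+1) - C 2 * X * HH x j (k+1)
      + derivative (HH x j (k+1)) - C (2 * ((k:ℝ)+1)) * HH x j k := by
    rw [HH_deriv, herm_deriv]
    simp only [HH]
    rw [show herm (j+1) = C 2 * X * herm j - derivative (herm j) from rfl]
    simp only [sub_comp, mul_comp, C_comp, X_comp, C_mul]
    ring
  rw [e, J_sub, J_add, J_sub, J_C_mul, J_C_mul, J_ibp]; push_cast; ring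

lemma HH_zero (x P : ℝ) (k : ℕ) :
    J P (HH x 0 k) = (2 * (x + Complex.I * P)) ^ k * J P 1 := by
  induction k with
  | zero => simp [HH, herm]
  | succ k ih => rw [HH_right, ih]; ring

lemma HH_formula (x P : ℝ) (j : ℕ) : ∀ m : ℕ,
    J P (HH x j (j + m)) = (-2) ^ j * (2 * (x + Complex.I * P)) ^ m *
      (((lagM j m).eval (2 * (x^2 + P^2)) : ℝ) : ℂ) * J P 1 := by
  induction j with
  | zero => intro m; simp [HH_zero, lagM]
  | succ j ih =>
    intro m
    rw [show j + 1 + m = (j + m) + 1 by ring, HH_left, ih, add_assoc, ih]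
    simp only [lagM, eval_sub, eval_mul, eval_C, eval_X]
    push_cast
    have hI : (2 * ((x:ℂ) - Complex.I * P)) * (2 * (x + Complex.I * P)) = 4 * (x^2 + P^2) := by
      linear_combination -4 * (P:ℂ)^2 * Complex.I_sq
    linear_combination ((-2)^j * (2 * ((x:ℂ) + Complex.I * P))^m *
      (((lagM j (m+1)).eval (2 * (x^2 + P^2)) : ℝ) : ℂ) * J P 1) * hI
end WC


namespace WC
open Polynomial
lemma psi_mul (h : ℝ) (hh : 0 < h) (k : ℕ) (x t : ℝ) :
    psiH h k (x - h * (2 / Real.sqrt h * t) / 2) * psiH h k (x + h * (2 / Real.sqrt h * t) / 2) =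
      (Real.sqrt Real.pi * 2^k * (Nat.factorial k) * Real.sqrt h)⁻¹ * Real.exp (-(x^2/h)) *
      ((HH (x / Real.sqrt h) k k).eval t * Real.exp (-t^2)) := by
  have hr : 0 < Real.sqrt h := Real.sqrt_pos.2 hh
  have hr2 : Real.sqrt h ^ 2 = h := Real.sq_sqrt hh.le
  have e1 : (x - h * (2 / Real.sqrt h * t) / 2) / Real.sqrt h = x / Real.sqrt h - t := by
    field_simp; linear_combination t * hr2
  have e2 : (x + h * (2 / Real.sqrt h * t) / 2) / Real.sqrt h = x / Real.sqrt h + t := by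
    field_simp; linear_combination -t * hr2
  have e3 : Real.exp (-(x - h * (2 / Real.sqrt h * t) / 2)^2 / (2*h)) *
      Real.exp (-(x + h * (2 / Real.sqrt h * t) / 2)^2 / (2*h)) =
      Real.exp (-(x^2/h)) * Real.exp (-t^2) := by
    rw [← Real.exp_add, ← Real.exp_add]
    congr 1
    have : h * (2 / Real.sqrt h * t) / 2 = Real.sqrt h * t := by
      field_simp; rw [hr2]
    rw [this]
    field_simp
    rw [mul_add]
    ring_nf
    rw [hr2]; ring
  have e4 : ∀ a : ℝ, 0 ≤ a → (Real.sqrt a)⁻¹ * (Real.sqrt a)⁻¹ = a⁻¹ := by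
    intro a ha; rw [← mul_inv, Real.mul_self_sqrt ha]
  unfold psiH
  rw [e1, e2, hermiteH_eq, hermiteH_eq]
  have e5 := e4 (Real.sqrt Real.pi * 2^k * (Nat.factorial k) * Real.sqrt h) (by positivity)
  simp only [HH, eval_mul, eval_comp, eval_sub, eval_add, eval_C, eval_X]
  rw [← e5]
  linear_combination ((Real.sqrt (Real.sqrt Real.pi * 2^k * (Nat.factorial k) * Real.sqrt h))⁻¹ *
   (Real.sqrt (Real.sqrt Real.pi * 2^k * (Nat.factorial k) * Real.sqrt h))⁻¹ *
   (herm k).eval (x / Real.sqrt h - t) * (herm k).eval (x / Real.sqrt h + t)) * e3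

lemma sigmaP_eq (h : ℝ) (hh : 0 < h) (N : ℕ) (x p : ℝ) :
    sigmaP h N x p =
      ((2 * (G N).eval (2 * (x^2 + p^2) / h) * Real.exp (-((x^2 + p^2) / h)) : ℝ) : ℂ) := by
  have hr : 0 < Real.sqrt h := Real.sqrt_pos.2 hh
  have hr2 : Real.sqrt h ^ 2 = h := Real.sq_sqrt hh.le
  have hsub := Measure.integral_comp_mul_left (fun y : ℝ =>
    ((h * KerK h N (x - h*y/2) (x + h*y/2) : ℝ) : ℂ) *
    Complex.exp (Complex.I * (p:ℂ) * (y:ℂ))) (2 / Real.sqrt h)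
  have hpt : ∀ t : ℝ, ((h * KerK h N (x - h*(2 / Real.sqrt h * t)/2)
      (x + h*(2 / Real.sqrt h * t)/2) : ℝ) : ℂ) *
      Complex.exp (Complex.I * (p:ℂ) * ((2 / Real.sqrt h * t : ℝ):ℂ)) =
      ∑ k ∈ Finset.range N, ((h * ((Real.sqrt Real.pi * 2^k * (Nat.factorial k) * Real.sqrt h)⁻¹ *
        Real.exp (-(x^2/h))) : ℝ) : ℂ) *
        ((((HH (x / Real.sqrt h) k k).eval t : ℝ) : ℂ) * osc (p / Real.sqrt h) t) := by
    intro t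
    have ho : osc (p / Real.sqrt h) t = ((Real.exp (-t^2) : ℝ) : ℂ) *
        Complex.exp (Complex.I * (p:ℂ) * ((2 / Real.sqrt h * t : ℝ):ℂ)) := by
      rw [osc, Complex.ofReal_exp, ← Complex.exp_add]
      congr 1
      push_cast; ring
    unfold KerK
    simp_rw [psi_mul h hh, ho]
    rw [Finset.mul_sum, Complex.ofReal_sum, Finset.sum_mul]
    refine Finset.sum_congr rfl fun k _ => ?_
    push_cast; ring
  simp_rw [hpt] at hsub
  rw [integral_finsetSum _ fun k _ => (poly_osc_integrable _ _).const_mul _] at hsub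
  simp_rw [integral_const_mul] at hsub
  have hJ : ∀ k, (∫ t : ℝ, (((HH (x / Real.sqrt h) k k).eval t : ℝ) : ℂ) * osc (p / Real.sqrt h) t)
      = (((-2)^k * (k.factorial * (lag k).eval (2 * (x^2 + p^2) / h)) *
        (Real.sqrt Real.pi * Real.exp (-(p^2/h))) : ℝ) : ℂ) := by
    intro k
    have := HH_formula (x / Real.sqrt h) (p / Real.sqrt h) k 0
    rw [add_zero, J_one] at this
    rw [J] at this
    rw [this]
    have e1 : 2 * ((x / Real.sqrt h)^2 + (p / Real.sqrt h)^2) = 2 * (x^2 + p^2) / h := by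
      rw [div_pow, div_pow, hr2]; ring
    have e2 : -(p / Real.sqrt h)^2 = -(p^2/h) := by rw [div_pow, hr2]
    rw [e1, e2]
    have hk : (k.factorial : ℝ) ≠ 0 := by positivity
    have e3 : (k.factorial : ℝ) * (lag k).eval (2 * (x^2 + p^2) / h) =
        (lagM k 0).eval (2 * (x^2 + p^2) / h) := by
      rw [lag, eval_mul, eval_C]; field_simp
    rw [e3]
    push_cast; ring
  simp_rw [hJ] at hsub
  have habs : |(2 / Real.sqrt h)⁻¹| = Real.sqrt h / 2 := by
    rw [inv_div, abs_of_pos (by positivity)]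
  rw [habs] at hsub
  have hfin : sigmaP h N x p = ((2 / Real.sqrt h : ℝ) : ℂ) * ((Real.sqrt h / 2 : ℝ) • sigmaP h N x p) := by
    rw [Complex.real_smul, ← mul_assoc, ← Complex.ofReal_mul]
    have : 2 / Real.sqrt h * (Real.sqrt h / 2) = 1 := by field_simp
    rw [this]; simp
  rw [hfin]
  unfold sigmaP
  rw [← hsub]
  simp_rw [← Complex.ofReal_mul]
  rw [← Complex.ofReal_sum, ← Complex.ofReal_mul]
  congr 1
  rw [G, eval_finsetSum, Finset.mul_sum, Finset.mul_sum, Finset.sum_mul]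
  refine Finset.sum_congr rfl fun k _ => ?_
  have e : Real.exp (-((x^2+p^2)/h)) = Real.exp (-(x^2/h)) * Real.exp (-(p^2/h)) := by
    rw [← Real.exp_add]; congr 1; ring
  rw [e, eval_mul, eval_C, show (-2:ℝ) = (-1) * 2 by norm_num, mul_pow]
  have hk : (k.factorial : ℝ) ≠ 0 := by positivity
  have hpi : Real.sqrt Real.pi ≠ 0 := (Real.sqrt_pos.2 Real.pi_pos).ne'
  field_simp
  rw [hr2]

/-- radial profile -/
noncomputable def S (h : ℝ) (N : ℕ) (r : ℝ) : ℝ :=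
  2 * (G N).eval (2 * r / h) * Real.exp (-(r / h))

lemma S_continuous (h : ℝ) (N : ℕ) : Continuous (S h N) := by
  unfold S; fun_prop

lemma resc (h : ℝ) (hh : 0 < h) (f : ℝ → ℝ) :
    ∫ r in Set.Ioi (0:ℝ), f (2 / h * r) = h / 2 * ∫ s in Set.Ioi (0:ℝ), f s := by
  have := integral_comp_mul_left_Ioi f 0 (b := 2 / h) (by positivity)
  rw [this]; simp

lemma resc_int (h : ℝ) (hh : 0 < h) (f : ℝ → ℝ) (hf : IntegrableOn f (Set.Ioi 0)) :
    IntegrableOn (fun r => f (2 / h * r)) (Set.Ioi 0) := by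
  have := (integrableOn_Ioi_comp_mul_left_iff f 0 (a := 2 / h) (by positivity)).2 (by simpa using hf)
  exact this

lemma S_sq (h : ℝ) (N : ℕ) (r : ℝ) : S h N r ^ 2 =
    (fun s => (C 4 * G N ^ 2).eval s * Real.exp (-(1 * s))) (2 / h * r) := by
  simp only [S, eval_mul, eval_C, eval_pow]
  rw [mul_pow, ← Real.exp_nat_mul]
  rw [show 2 * r / h = 2 / h * r by ring, show ((2:ℕ):ℝ) * -(r/h) = -(1 * (2 / h * r)) by
    push_cast; ring]
  ring

lemma S_sq_int (h : ℝ) (hh : 0 < h) (N : ℕ) :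
    IntegrableOn (fun r => S h N r ^ 2) (Set.Ioi 0) := by
  simp_rw [S_sq]
  exact resc_int h hh _ (poly_exp_integrable 1 one_pos _)

lemma S_sq_integral (h : ℝ) (hh : 0 < h) (N : ℕ) :
    ∫ r in Set.Ioi (0:ℝ), S h N r ^ 2 = 2 * h * N := by
  simp_rw [S_sq]
  refine (resc h hh (fun s => (C 4 * G N ^ 2).eval s * Real.exp (-(1 * s)))).trans ?_
  have : ∫ s in Set.Ioi (0:ℝ), (C 4 * G N ^ 2).eval s * Real.exp (-(1 * s)) = El (C 4 * G N ^ 2) :=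
    rfl
  rw [this, El_C_mul, El_G_sq]; ring

lemma S_wsq (h : ℝ) (hh : 0 < h) (N : ℕ) (r : ℝ) : r ^ 2 * S h N r ^ 2 =
    (fun s => (C (h ^ 2) * (X * G N) ^ 2).eval s * Real.exp (-(1 * s))) (2 / h * r) := by
  rw [S_sq]
  simp only [eval_mul, eval_C, eval_pow, eval_X]
  field_simp
  ring

lemma S_wsq_int (h : ℝ) (hh : 0 < h) (N : ℕ) :
    IntegrableOn (fun r => r ^ 2 * S h N r ^ 2) (Set.Ioi 0) := by
  simp_rw [S_wsq h hh]
  exact resc_int h hh _ (poly_exp_integrable 1 one_pos _)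

lemma S_wsq_integral (h : ℝ) (hh : 0 < h) (N : ℕ) :
    ∫ r in Set.Ioi (0:ℝ), r ^ 2 * S h N r ^ 2 ≤ 9 * (h * N) ^ 3 := by
  simp_rw [S_wsq h hh]
  refine (resc h hh (fun s => (C (h ^ 2) * (X * G N) ^ 2).eval s *
    Real.exp (-(1 * s)))).trans_le ?_
  have : ∫ s in Set.Ioi (0:ℝ), (C (h ^ 2) * (X * G N) ^ 2).eval s * Real.exp (-(1 * s)) =
    El (C (h ^ 2) * (X * G N) ^ 2) := rfl
  rw [this, El_C_mul]
  calc h / 2 * (h ^ 2 * El ((X * G N) ^ 2)) ≤ h / 2 * (h ^ 2 * (18 * N ^ 3)) := by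
        gcongr; exact El_XG_sq N
    _ = _ := by ring

lemma S_lap (h : ℝ) (hh : 0 < h) (N : ℕ) (t r : ℝ) : S h N r * Real.exp (-(t * r)) =
    (fun s => (C 2 * G N).eval s * Real.exp (-((1 + t * h) / 2 * s))) (2 / h * r) := by
  simp only [S, eval_mul, eval_C]
  rw [mul_assoc, ← Real.exp_add, show 2 * r / h = 2 / h * r by ring]
  congr 2
  field_simp
  ring

lemma S_lap_int (h : ℝ) (hh : 0 < h) (N : ℕ) (t : ℝ) (ht : 0 ≤ t) :
    IntegrableOn (fun r => S h N r * Real.exp (-(t * r))) (Set.Ioi 0) := by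
  simp_rw [S_lap h hh]
  exact resc_int h hh _ (poly_exp_integrable _ (by positivity) _)

lemma S_lap_integral (h : ℝ) (hh : 0 < h) (N : ℕ) (t : ℝ) (ht : 0 < t) :
    ∫ r in Set.Ioi (0:ℝ), S h N r * Real.exp (-(t * r)) =
      (1 - ((1 - t * h) / (1 + t * h)) ^ N) / t := by
  simp_rw [S_lap h hh]
  refine (resc h hh (fun s => (C 2 * G N).eval s * Real.exp (-((1 + t * h) / 2 * s)))).trans ?_
  set a := (1 + t * h) / 2 with ha
  have hth : 0 < t * h := by positivity
  have ha0 : 0 < a := by positivity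
  simp_rw [G, Finset.mul_sum, eval_finsetSum, Finset.sum_mul, eval_mul, eval_C, mul_assoc]
  rw [integral_finsetSum _ fun k _ => ((poly_exp_integrable a ha0 _).const_mul _).const_mul _]
  simp_rw [integral_const_mul, lag_laplace a ha0]
  have hq : (1 - t * h) / (1 + t * h) = -(1 - 1 / a) := by
    rw [ha]; field_simp; ring
  rw [hq]
  have hq1 : -(1 - 1 / a) ≠ 1 := by
    rw [← hq]
    intro hc
    rw [div_eq_one_iff_eq (by positivity)] at hc
    linarith
  have hg := geom_sum_eq hq1 N
  have : ∀ k ∈ Finset.range N, 2 * ((-1) ^ k * (1 / a * (1 - 1 / a) ^ k)) =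
      2 * (1 / a) * (-(1 - 1 / a)) ^ k := by
    intro k _; rw [neg_pow (1 - 1/a)]; ring
  rw [Finset.sum_congr rfl this, ← Finset.mul_sum, hg]
  have h3 : -(1 - 1 / a) - 1 = - (t * h / a) := by
    rw [ha]; field_simp; ring
  rw [h3]
  field_simp
  ring

lemma q_tendsto (μ : ℝ) (t : ℝ) :
    Tendsto (fun N : ℕ => ((1 - t * (μ / N)) / (1 + t * (μ / N))) ^ N) atTop
      (nhds (Real.exp (-(t * (2 * μ))))) := by
  have h1 := Real.tendsto_one_add_div_pow_exp (-(t * μ))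
  have h2 := Real.tendsto_one_add_div_pow_exp (t * μ)
  have h3 := h1.div h2 (Real.exp_pos _).ne'
  rw [← Real.exp_sub] at h3
  convert h3 using 2
  · rw [Pi.div_apply, ← div_pow]; congr 2 <;> ring
  · ring_nf

lemma S_lap_tendsto (μ : ℝ) (hμ : 0 < μ) (t : ℝ) (ht : 0 < t) :
    Tendsto (fun N : ℕ => ∫ r in Set.Ioi (0:ℝ), S (μ / N) N r * Real.exp (-(t * r))) atTop
      (nhds ((1 - Real.exp (-(t * (2 * μ)))) / t)) := by
  refine (((q_tendsto μ t).const_sub 1).div_const t).congr' ?_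
  filter_upwards [eventually_gt_atTop 0] with N hN
  rw [S_lap_integral _ (by positivity) N t ht]

end WC

namespace WC
open Polynomial
/-- Indicator of `r < T`. -/
noncomputable def chi (T r : ℝ) : ℝ := if r < T then 1 else 0

lemma chi_sq (T r : ℝ) : chi T r ^ 2 = chi T r := by
  unfold chi; split_ifs <;> norm_num

lemma chi_eq_ind (T : ℝ) : chi T = Set.indicator (Set.Iio T) (fun _ => (1:ℝ)) := by
  ext r; simp [chi, Set.indicator]

lemma chi_mul_eq (T : ℝ) (f : ℝ → ℝ) :
    (fun r => chi T r * f r) = Set.indicator (Set.Iio T) f := by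
  ext r; simp [chi, Set.indicator]

lemma chi_mul_int {T : ℝ} {f : ℝ → ℝ} (hf : IntegrableOn f (Set.Ioi 0)) :
    IntegrableOn (fun r => chi T r * f r) (Set.Ioi 0) := by
  rw [chi_mul_eq]
  exact Integrable.indicator hf measurableSet_Iio

lemma chi_mul_integral (T : ℝ) (f : ℝ → ℝ) :
    ∫ r in Set.Ioi 0, chi T r * f r = ∫ r in Set.Ioo 0 T, f r := by
  rw [chi_mul_eq, setIntegral_indicator measurableSet_Iio]
  rfl

lemma chi_int (T : ℝ) : IntegrableOn (chi T) (Set.Ioi 0) := by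
  rw [chi_eq_ind, IntegrableOn, integrable_indicator_iff measurableSet_Iio, IntegrableOn,
    Measure.restrict_restrict measurableSet_Iio]
  refine integrableOn_const ?_
  have : Set.Iio T ∩ Set.Ioi 0 ⊆ Set.Ioo 0 T := fun x hx => ⟨hx.2, hx.1⟩
  exact ((measure_mono this).trans_lt (by simp)).ne

lemma chi_integral (T : ℝ) (hT : 0 ≤ T) : ∫ r in Set.Ioi 0, chi T r = T := by
  have := chi_mul_integral T (fun _ => 1)
  simp only [mul_one] at this
  rw [this]
  simp [hT]

/-- The exponential polynomial attached to `q`. -/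
noncomputable def gq (q : ℝ[X]) (r : ℝ) : ℝ := Real.exp (-r) * q.eval (Real.exp (-r))

lemma gq_cont (q : ℝ[X]) : Continuous (gq q) := by
  unfold gq
  have : Continuous fun r : ℝ => Real.exp (-r) := by fun_prop
  exact this.mul (q.continuous.comp this)

lemma gq_eq (q : ℝ[X]) (r : ℝ) :
    gq q r = ∑ j ∈ Finset.range (q.natDegree + 1), q.coeff j * Real.exp (-(((j:ℝ)+1)*r)) := by
  unfold gq
  rw [eval_eq_sum_range, Finset.mul_sum]
  refine Finset.sum_congr rfl fun j _ => ?_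
  rw [← Real.exp_nat_mul, mul_left_comm, ← Real.exp_add]
  congr 2; ring

lemma approx (T : ℝ) (hT : 0 < T) (ε : ℝ) (hε : 0 < ε) :
    ∃ q : ℝ[X], IntegrableOn (fun r => (chi T r - gq q r)^2) (Set.Ioi 0) ∧
      ∫ r in Set.Ioi 0, (chi T r - gq q r)^2 ≤ ε := by
  set δ := ε / 4 with hδ
  have hδ0 : 0 < δ := by positivity
  set k : ℝ → ℝ := fun r => max 0 (min 1 ((T - r)/δ)) with hk
  set c := Real.exp (-T) with hc
  have hc0 : 0 < c := Real.exp_pos _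
  set F : ℝ → ℝ := fun w => k (-Real.log (max w c)) / max w c with hF
  have hm : ∀ w : ℝ, max w c ≠ 0 := fun w => (lt_max_of_lt_right hc0).ne'
  have hkc : Continuous k := by
    simp only [hk]; fun_prop
  have hFc : Continuous F := by
    have h1 : Continuous fun w : ℝ => max w c := by fun_prop
    exact (hkc.comp (h1.log hm).neg).div h1 hm
  set η := min 1 (ε/4) with hη
  have hη0 : 0 < η := by positivity
  obtain ⟨q, hq⟩ := exists_polynomial_near_of_continuousOn 0 1 F hFc.continuousOn η hη0
  refine ⟨q, ?_⟩
  have hkF : ∀ r : ℝ, Real.exp (-r) * F (Real.exp (-r)) = k r := by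
    intro r
    simp only [hF]
    rcases le_total r T with h | h
    · have : max (Real.exp (-r)) c = Real.exp (-r) :=
        max_eq_left (Real.exp_le_exp.2 (by linarith))
      rw [this, Real.log_exp, neg_neg]
      field_simp
    · have : max (Real.exp (-r)) c = c :=
        max_eq_right (Real.exp_le_exp.2 (by linarith))
      rw [this, hc, Real.log_exp, neg_neg]
      have h1 : k T = 0 := by simp [hk]
      have h2 : k r = 0 := by
        simp only [hk]
        apply max_eq_left
        exact (min_le_right _ _).trans (div_nonpos_of_nonpos_of_nonneg (by linarith) hδ0.le)
      rw [h1, h2]; simp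
  have hgk : ∀ r : ℝ, 0 < r → (gq q r - k r)^2 ≤ η^2 * Real.exp (-r) := by
    intro r hr
    have e0 := Real.exp_pos (-r)
    have e1 : Real.exp (-r) ≤ 1 := Real.exp_le_one_iff.2 (by linarith)
    have h1 := (hq (Real.exp (-r)) ⟨e0.le, e1⟩).le
    rw [← hkF, gq, ← mul_sub, mul_pow]
    have h2 := sq_le_sq' (neg_le_of_abs_le h1) (le_of_abs_le h1)
    have h3 : Real.exp (-r) ^ 2 ≤ Real.exp (-r) := by nlinarith
    calc _ ≤ Real.exp (-r) * η^2 := by gcongr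
      _ = _ := by ring
  set I : ℝ → ℝ := Set.indicator (Set.Icc (T-δ) T) (fun _ => (1:ℝ)) with hI
  have hck : ∀ r, (chi T r - k r)^2 ≤ I r := by
    intro r
    have k0 : 0 ≤ k r := le_max_left _ _
    have k1 : k r ≤ 1 := max_le zero_le_one (min_le_left _ _)
    by_cases h1 : r < T - δ
    · have : k r = 1 := by
        simp only [hk]
        rw [min_eq_left, max_eq_right zero_le_one]
        rw [le_div_iff₀ hδ0]; linarith
      have h2 : chi T r = 1 := if_pos (by linarith)
      rw [this, h2]; simp only [hI, Set.indicator]; split_ifs <;> norm_num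
    · by_cases h2 : T < r
      · have : k r = 0 := by
          simp only [hk]
          apply max_eq_left
          exact (min_le_right _ _).trans (div_nonpos_of_nonpos_of_nonneg (by linarith) hδ0.le)
        have h2 : chi T r = 0 := if_neg (by linarith)
        rw [this, h2]; simp only [hI, Set.indicator]; split_ifs <;> norm_num
      · have : I r = 1 := Set.indicator_of_mem (by constructor <;> linarith) _
        rw [this]
        have : 0 ≤ chi T r ∧ chi T r ≤ 1 := by unfold chi; split_ifs <;> norm_num
        nlinarith
  have hIi : IntegrableOn I (Set.Ioi 0) := by
    refine Integrable.integrableOn ?_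
    rw [hI, integrable_indicator_iff measurableSet_Icc]
    exact integrableOn_const (by simp)
  have hIv : ∫ r in Set.Ioi 0, I r ≤ δ := by
    have h1 : Integrable I := by
      rw [hI, integrable_indicator_iff measurableSet_Icc]
      exact integrableOn_const (by simp)
    have h2 : ∫ r, I r = δ := by
      rw [hI, integral_indicator measurableSet_Icc]; simp [hδ0.le]
    rw [← h2]
    refine setIntegral_le_integral h1 (Eventually.of_forall fun r => ?_)
    exact Set.indicator_nonneg (fun _ _ => zero_le_one) _
  have hEi : IntegrableOn (fun r : ℝ => Real.exp (-r)) (Set.Ioi 0) := integrableOn_exp_neg_Ioi 0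
  have hEv : ∫ r in Set.Ioi (0:ℝ), Real.exp (-r) = 1 := by simpa using integral_exp_neg_Ioi 0
  have hbd : ∀ r : ℝ, 0 < r → (chi T r - gq q r)^2 ≤ 2 * I r + 2*η^2 * Real.exp (-r) := by
    intro r hr
    nlinarith [hck r, hgk r hr, sq_nonneg ((chi T r - k r) + (gq q r - k r))]
  have hBi : IntegrableOn (fun r => 2 * I r + 2*η^2 * Real.exp (-r)) (Set.Ioi 0) :=
    (hIi.const_mul 2).add (hEi.const_mul _)
  have hmeas : Measurable fun r => (chi T r - gq q r)^2 := by
    have : Measurable (chi T) := by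
      rw [chi_eq_ind]; exact measurable_const.indicator measurableSet_Iio
    exact (this.sub (gq_cont q).measurable).pow_const 2
  have hIntg : IntegrableOn (fun r => (chi T r - gq q r)^2) (Set.Ioi 0) := by
    refine Integrable.mono' hBi hmeas.aestronglyMeasurable ?_
    filter_upwards [ae_restrict_mem measurableSet_Ioi] with r hr
    rw [Real.norm_of_nonneg (sq_nonneg _)]
    exact hbd r hr
  refine ⟨hIntg, ?_⟩
  calc _ ≤ ∫ r in Set.Ioi 0, (2 * I r + 2*η^2 * Real.exp (-r)) :=
        setIntegral_mono_on hIntg hBi measurableSet_Ioi hbd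
    _ = 2 * (∫ r in Set.Ioi 0, I r) + 2*η^2 := by
        rw [integral_add (hIi.const_mul 2) (hEi.const_mul _), integral_const_mul,
          integral_const_mul, hEv, mul_one]
    _ ≤ ε := by
        have a1 : η ≤ 1 := min_le_left _ _
        have a2 : η ≤ ε/4 := min_le_right _ _
        nlinarith

lemma amgm (s : Set ℝ) (hs : MeasurableSet s) (a b : ℝ → ℝ) (ha : IntegrableOn (fun r => a r^2) s)
    (hb : IntegrableOn (fun r => b r^2) s) (η : ℝ) (hη : 0 < η) :
    |∫ r in s, a r * b r| ≤ ((∫ r in s, a r^2) / η + η * ∫ r in s, b r^2) / 2 := by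
  have h1 : ∀ r, ‖a r * b r‖ ≤ (η⁻¹/2) * a r^2 + (η/2) * b r^2 := by
    intro r
    rw [Real.norm_eq_abs, abs_le]
    have hη1 : η⁻¹ * η = 1 := inv_mul_cancel₀ hη.ne'
    have hi : 0 < η⁻¹ := inv_pos.2 hη
    have p1 : 0 ≤ η⁻¹ * (a r - η * b r)^2 := by positivity
    have p2 : 0 ≤ η⁻¹ * (a r + η * b r)^2 := by positivity
    have e1 : η⁻¹ * (a r - η * b r)^2 = η⁻¹ * a r^2 - 2 * a r * b r + η * b r^2 := by
      field_simp; ring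
    have e2 : η⁻¹ * (a r + η * b r)^2 = η⁻¹ * a r^2 + 2 * a r * b r + η * b r^2 := by
      field_simp; ring
    constructor <;> nlinarith
  have := norm_integral_le_of_norm_le (μ := volume.restrict s)
    ((ha.const_mul (η⁻¹/2)).add (hb.const_mul (η/2))) (Eventually.of_forall h1)
  rw [← Real.norm_eq_abs]
  refine this.trans (le_of_eq ?_)
  simp only [Pi.add_apply]
  rw [integral_add (ha.const_mul (η⁻¹/2)) (hb.const_mul (η/2)), integral_const_mul,
    integral_const_mul]
  field_simp

end WC

namespace WC
open Polynomial
lemma exp_int0 (t T : ℝ) (ht : 0 < t) (hT : 0 < T) :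
    ∫ r in Set.Ioo 0 T, Real.exp (-(t*r)) = (1 - Real.exp (-(t*T)))/t := by
  rw [← integral_Ioc_eq_integral_Ioo, ← intervalIntegral.integral_of_le hT.le]
  have h : ∀ x ∈ Set.uIcc 0 T, HasDerivAt (fun r => -Real.exp (-(t*r)) / t)
      (Real.exp (-(t*x))) x := by
    intro x _
    have h1 : HasDerivAt (fun r : ℝ => -(t*r)) (-(t*1)) x := ((hasDerivAt_id x).const_mul t).neg
    refine (h1.exp.neg.div_const t).congr_deriv ?_
    field_simp
  rw [intervalIntegral.integral_eq_sub_of_hasDerivAt h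
    ((by fun_prop : Continuous fun r : ℝ => Real.exp (-(t*r))).intervalIntegrable _ _)]
  simp; ring

lemma lap_poly (T : ℝ) (hT : 0 < T) (f : ℕ → ℝ → ℝ)
    (hli : ∀ n, ∀ t : ℝ, 0 ≤ t → IntegrableOn (fun r => f n r * Real.exp (-(t*r))) (Set.Ioi 0))
    (hl : ∀ t : ℝ, 0 < t → Tendsto (fun n => ∫ r in Set.Ioi 0, f n r * Real.exp (-(t*r))) atTop
      (nhds ((1 - Real.exp (-(t*T)))/t))) (q : ℝ[X]) :
    (∀ n, IntegrableOn (fun r => gq q r * f n r) (Set.Ioi 0)) ∧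
    IntegrableOn (gq q) (Set.Ioi 0) ∧
    Tendsto (fun n => ∫ r in Set.Ioi 0, gq q r * f n r) atTop
      (nhds (∫ r in Set.Ioi 0, chi T r * gq q r)) := by
  have e : ∀ n, (fun r => gq q r * f n r) = fun r =>
      ∑ j ∈ Finset.range (q.natDegree + 1), q.coeff j *
        (f n r * Real.exp (-(((j:ℝ)+1)*r))) := by
    intro n; ext r; rw [gq_eq, Finset.sum_mul]
    exact Finset.sum_congr rfl fun j _ => by ring
  have i1 : ∀ n, ∀ j ∈ Finset.range (q.natDegree + 1), IntegrableOn (fun r => q.coeff j *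
        (f n r * Real.exp (-(((j:ℝ)+1)*r)))) (Set.Ioi 0) := by
    intro n j _
    exact (hli n _ (by positivity)).const_mul _
  have i2 : ∀ j ∈ Finset.range (q.natDegree + 1), IntegrableOn (fun r => q.coeff j *
        (Real.exp (-(((j:ℝ)+1)*r)))) (Set.Ioi 0) := by
    intro j _
    have := exp_neg_integrableOn_Ioi 0 (b := (j:ℝ)+1) (by positivity)
    simp only [neg_mul] at this
    exact this.const_mul _
  have i3 : ∀ j ∈ Finset.range (q.natDegree + 1), IntegrableOn (fun r => q.coeff j *
        (Real.exp (-(((j:ℝ)+1)*r)))) (Set.Ioo 0 T) := fun j hj =>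
    (i2 j hj).mono_set Set.Ioo_subset_Ioi_self
  refine ⟨?_, ?_, ?_⟩
  · intro n; rw [e n]
    exact integrable_finsetSum _ (i1 n)
  · have : gq q = fun r => ∑ j ∈ Finset.range (q.natDegree + 1), q.coeff j *
        (Real.exp (-(((j:ℝ)+1)*r))) := by ext r; exact gq_eq q r
    rw [this]
    exact integrable_finsetSum _ i2
  · rw [chi_mul_integral]
    simp_rw [e, gq_eq]
    rw [integral_finsetSum _ i3]
    have : ∀ n, ∫ r in Set.Ioi 0, ∑ j ∈ Finset.range (q.natDegree + 1), q.coeff j *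
        (f n r * Real.exp (-(((j:ℝ)+1)*r))) = ∑ j ∈ Finset.range (q.natDegree + 1), q.coeff j *
        ∫ r in Set.Ioi 0, (f n r * Real.exp (-(((j:ℝ)+1)*r))) := by
      intro n
      rw [integral_finsetSum _ (i1 n)]
      simp_rw [integral_const_mul]
    simp_rw [this, integral_const_mul]
    refine tendsto_finsetSum _ fun j _ => ?_
    rw [exp_int0 _ _ (by positivity) hT]
    exact (hl _ (by positivity)).const_mul _

lemma chi_conv (T : ℝ) (hT : 0 < T) (f : ℕ → ℝ → ℝ)
    (hli : ∀ n, ∀ t : ℝ, 0 ≤ t → IntegrableOn (fun r => f n r * Real.exp (-(t*r))) (Set.Ioi 0))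
    (hl : ∀ t : ℝ, 0 < t → Tendsto (fun n => ∫ r in Set.Ioi 0, f n r * Real.exp (-(t*r))) atTop
      (nhds ((1 - Real.exp (-(t*T)))/t)))
    (hsi : ∀ n, IntegrableOn (fun r => f n r^2) (Set.Ioi 0))
    (hs : ∀ n, ∫ r in Set.Ioi 0, f n r^2 = T) :
    Tendsto (fun n => ∫ r in Set.Ioi 0, chi T r * f n r) atTop (nhds T) := by
  have hfi : ∀ n, IntegrableOn (f n) (Set.Ioi 0) := by
    intro n; simpa using hli n 0 le_rfl
  rw [Metric.tendsto_atTop]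
  intro ε hε
  set η := ε / (2 * (1 + T)) with hη
  have hη0 : 0 < η := by positivity
  obtain ⟨q, hqi, hq⟩ := approx T hT (η^2) (by positivity)
  obtain ⟨j1, j2, j3⟩ := lap_poly T hT f hli hl q
  obtain ⟨n0, hn0⟩ := Metric.tendsto_atTop.1 j3 (ε/4) (by positivity)
  refine ⟨n0, fun n hn => ?_⟩
  have h0 := hn0 n hn
  rw [Real.dist_eq] at h0 ⊢
  have hci : IntegrableOn (fun r => chi T r^2) (Set.Ioi 0) := by
    simp_rw [chi_sq]; exact chi_int T
  have hcv : ∫ r in Set.Ioi 0, chi T r^2 = T := by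
    simp_rw [chi_sq]; exact chi_integral T hT.le
  have A1 := amgm _ measurableSet_Ioi (fun r => chi T r - gq q r) (f n) hqi (hsi n) η hη0
  have A2 := amgm _ measurableSet_Ioi (fun r => chi T r - gq q r) (chi T) hqi hci η hη0
  rw [hs n] at A1
  rw [hcv] at A2
  have B : (∫ r in Set.Ioi 0, (chi T r - gq q r)^2) / η ≤ η := by
    rw [div_le_iff₀ hη0]; nlinarith
  have e1 : ∫ r in Set.Ioi 0, (chi T r - gq q r) * f n r =
      (∫ r in Set.Ioi 0, chi T r * f n r) - ∫ r in Set.Ioi 0, gq q r * f n r := by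
    rw [← integral_sub (chi_mul_int (hfi n)) (j1 n)]
    simp_rw [sub_mul]
  have e2 : ∫ r in Set.Ioi 0, (chi T r - gq q r) * chi T r =
      T - ∫ r in Set.Ioi 0, chi T r * gq q r := by
    refine Eq.trans ?_ (congrArg (fun z => z - ∫ r in Set.Ioi 0, chi T r * gq q r) hcv)
    rw [← integral_sub hci (chi_mul_int j2)]
    congr 1; ext r; ring
  rw [e1] at A1
  rw [e2] at A2
  have hηT : η * (1 + T) = ε / 2 := by rw [hη]; field_simp
  rw [abs_lt] at h0 ⊢
  rw [abs_le] at A1 A2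
  constructor <;> nlinarith

lemma l2_conv (T : ℝ) (hT : 0 < T) (f : ℕ → ℝ → ℝ)
    (hli : ∀ n, ∀ t : ℝ, 0 ≤ t → IntegrableOn (fun r => f n r * Real.exp (-(t*r))) (Set.Ioi 0))
    (hl : ∀ t : ℝ, 0 < t → Tendsto (fun n => ∫ r in Set.Ioi 0, f n r * Real.exp (-(t*r))) atTop
      (nhds ((1 - Real.exp (-(t*T)))/t)))
    (hsi : ∀ n, IntegrableOn (fun r => f n r^2) (Set.Ioi 0))
    (hs : ∀ n, ∫ r in Set.Ioi 0, f n r^2 = T) :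
    (∀ n, IntegrableOn (fun r => (f n r - chi T r)^2) (Set.Ioi 0)) ∧
    Tendsto (fun n => ∫ r in Set.Ioi 0, (f n r - chi T r)^2) atTop (nhds 0) := by
  have hfi : ∀ n, IntegrableOn (f n) (Set.Ioi 0) := by
    intro n; simpa using hli n 0 le_rfl
  have e : ∀ n, (fun r => (f n r - chi T r)^2) =
      fun r => f n r^2 + chi T r - 2 * (chi T r * f n r) := by
    intro n; ext r
    linear_combination chi_sq T r
  have ei : ∀ n, ∫ r in Set.Ioi 0, (f n r - chi T r)^2 =
      T + T - 2 * ∫ r in Set.Ioi 0, chi T r * f n r := by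
    intro n
    have h1 : IntegrableOn (fun r => f n r^2 + chi T r) (Set.Ioi 0) := (hsi n).add (chi_int T)
    rw [e n, integral_sub h1 ((chi_mul_int (hfi n)).const_mul 2),
      integral_add (hsi n) (chi_int T), hs n, chi_integral T hT.le, integral_const_mul]
  refine ⟨fun n => ?_, ?_⟩
  · rw [e n]
    exact ((hsi n).add (chi_int T)).sub ((chi_mul_int (hfi n)).const_mul 2)
  · simp_rw [ei]
    have := (chi_conv T hT f hli hl hsi hs).const_mul 2 |>.const_sub (T+T)
    convert this using 2; ring

lemma l1_conv (T : ℝ) (hT : 0 < T) (f : ℕ → ℝ → ℝ) (C : ℝ)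
    (hli : ∀ n, ∀ t : ℝ, 0 ≤ t → IntegrableOn (fun r => f n r * Real.exp (-(t*r))) (Set.Ioi 0))
    (hl : ∀ t : ℝ, 0 < t → Tendsto (fun n => ∫ r in Set.Ioi 0, f n r * Real.exp (-(t*r))) atTop
      (nhds ((1 - Real.exp (-(t*T)))/t)))
    (hsi : ∀ n, IntegrableOn (fun r => f n r^2) (Set.Ioi 0))
    (hs : ∀ n, ∫ r in Set.Ioi 0, f n r^2 = T)
    (hwi : ∀ n, IntegrableOn (fun r => r^2 * f n r^2) (Set.Ioi 0))
    (hw : ∀ n, ∫ r in Set.Ioi 0, r^2 * f n r^2 ≤ C) :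
    Tendsto (fun n => ∫ r in Set.Ioi 0, |f n r - chi T r|) atTop (nhds 0) := by
  have hfi : ∀ n, IntegrableOn (f n) (Set.Ioi 0) := by
    intro n; simpa using hli n 0 le_rfl
  obtain ⟨d1, d2⟩ := l2_conv T hT f hli hl hsi hs
  have hai : ∀ n, IntegrableOn (fun r => |f n r - chi T r|) (Set.Ioi 0) :=
    fun n => ((hfi n).sub (chi_int T)).abs
  have hC : 0 ≤ C := (setIntegral_nonneg measurableSet_Ioi
    (fun r _ => by positivity)).trans (hw 0)
  rw [Metric.tendsto_atTop]
  intro ε hε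
  -- parameters
  set δ := ε / (2 * (C + 1)) with hδ
  have hδ0 : 0 < δ := by positivity
  set R := T + 2 / (δ * ε) with hR
  have hR0 : 0 < R := by positivity
  have hRT : T ≤ R := by rw [hR]; linarith [show 0 < 2 / (δ * ε) by positivity]
  have hRinv : 1 / (δ * R) ≤ ε / 2 := by
    rw [div_le_iff₀ (by positivity), hR]
    have : ε / 2 * (δ * (T + 2 / (δ * ε))) = ε / 2 * δ * T + 1 := by field_simp
    rw [this]; nlinarith [mul_pos (mul_pos hε hδ0) hT]
  set κ := ε / (4 * R) with hκ
  have hκ0 : 0 < κ := by positivity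
  obtain ⟨n0, hn0⟩ := Metric.tendsto_atTop.1 d2 (κ * ε / 4) (by positivity)
  refine ⟨n0, fun n hn => ?_⟩
  have h0 := hn0 n hn
  rw [Real.dist_eq, sub_zero] at h0 ⊢
  have h0 := (le_abs_self _).trans_lt h0
  rw [abs_of_nonneg (setIntegral_nonneg measurableSet_Ioi (fun r _ => abs_nonneg _))]
  have hu : Set.Ioi (0:ℝ) = Set.Ioc 0 R ∪ Set.Ioi R := (Set.Ioc_union_Ioi_eq_Ioi hR0.le).symm
  have hsplit : ∫ r in Set.Ioi 0, |f n r - chi T r| =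
      (∫ r in Set.Ioc 0 R, |f n r - chi T r|) + ∫ r in Set.Ioi R, |f n r - chi T r| := by
    rw [hu]
    refine setIntegral_union (Set.Ioc_disjoint_Ioi le_rfl) measurableSet_Ioi ?_ ?_
    · exact (hai n).mono_set Set.Ioc_subset_Ioi_self
    · exact (hai n).mono_set (Set.Ioi_subset_Ioi hR0.le)
  have P1 : ∫ r in Set.Ioc 0 R, |f n r - chi T r| ≤
      (∫ r in Set.Ioi 0, (f n r - chi T r)^2) / (2*κ) + κ * R / 2 := by
    have b1 : IntegrableOn (fun r => (f n r - chi T r)^2 / (2*κ)) (Set.Ioc 0 R) :=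
      ((d1 n).mono_set Set.Ioc_subset_Ioi_self).div_const _
    have b2 : IntegrableOn (fun _ : ℝ => κ/2) (Set.Ioc 0 R) := integrableOn_const (by simp)
    have : ∫ r in Set.Ioc 0 R, |f n r - chi T r| ≤
        ∫ r in Set.Ioc 0 R, ((f n r - chi T r)^2/(2*κ) + κ/2) := by
      refine setIntegral_mono_on ((hai n).mono_set Set.Ioc_subset_Ioi_self) (b1.add b2)
        measurableSet_Ioc fun r _ => ?_
      have := sq_nonneg (|f n r - chi T r| - κ)
      rw [← sq_abs (f n r - chi T r)]
      rw [← sub_nonneg]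
      have e : |f n r - chi T r|^2/(2*κ) + κ/2 - |f n r - chi T r| =
        (|f n r - chi T r| - κ)^2 / (2*κ) := by field_simp; ring
      rw [e]; positivity
    refine this.trans ?_
    rw [integral_add b1 b2, integral_div]
    have m : ∫ r in Set.Ioc 0 R, (f n r - chi T r)^2 ≤ ∫ r in Set.Ioi 0, (f n r - chi T r)^2 :=
      setIntegral_mono_set (d1 n) (Eventually.of_forall fun r => sq_nonneg _)
        (Set.Ioc_subset_Ioi_self.eventuallyLE)
    have v : ∫ _ in Set.Ioc 0 R, κ/2 = κ * R / 2 := by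
      simp [hR0.le]; ring
    rw [v]
    gcongr
  have P2 : ∫ r in Set.Ioi R, |f n r - chi T r| ≤ δ * C / 2 + 1 / (δ * R) / 2 := by
    have b1 : IntegrableOn (fun r => (δ/2) * (r^2 * f n r^2)) (Set.Ioi R) :=
      ((hwi n).mono_set (Set.Ioi_subset_Ioi hR0.le)).const_mul _
    have b2 : IntegrableOn (fun r : ℝ => (1/(2*δ)) * r^(-2:ℝ)) (Set.Ioi R) :=
      (integrableOn_Ioi_rpow_of_lt (by norm_num) hR0).const_mul _
    have : ∫ r in Set.Ioi R, |f n r - chi T r| ≤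
        ∫ r in Set.Ioi R, ((δ/2) * (r^2 * f n r^2) + (1/(2*δ)) * r^(-2:ℝ)) := by
      refine setIntegral_mono_on ((hai n).mono_set (Set.Ioi_subset_Ioi hR0.le)) (b1.add b2)
        measurableSet_Ioi fun r hr => ?_
      have hr' : R < r := hr
      have hr0 : 0 < r := hR0.trans hr'
      have c0 : chi T r = 0 := if_neg (by linarith)
      rw [c0, sub_zero, ← sq_abs (f n r), ← sub_nonneg, Real.rpow_neg hr0.le, Real.rpow_two]
      have e : (δ/2) * (r^2 * |f n r|^2) + (1/(2*δ)) * (r^2)⁻¹ - |f n r| =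
        (δ * r^2 * |f n r| - 1)^2 / (2 * δ * r^2) := by field_simp; ring
      rw [e]; positivity
    refine this.trans ?_
    rw [integral_add b1 b2, integral_const_mul, integral_const_mul,
      integral_Ioi_rpow_of_lt (by norm_num) hR0]
    have m : ∫ r in Set.Ioi R, r^2 * f n r^2 ≤ C :=
      (setIntegral_mono_set (hwi n) (Eventually.of_forall fun r => by positivity)
        ((Set.Ioi_subset_Ioi hR0.le).eventuallyLE)).trans (hw n)
    have v : 1/(2*δ) * (-R^((-2:ℝ)+1)/((-2:ℝ)+1)) = 1 / (δ * R) / 2 := by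
      norm_num
      rw [Real.rpow_neg_one]; field_simp
    rw [v]
    nlinarith
  have Q1 : (∫ r in Set.Ioi 0, (f n r - chi T r)^2) / (2*κ) ≤ ε / 8 := by
    rw [div_le_iff₀ (by positivity)]; linarith
  have Q2 : κ * R / 2 = ε / 8 := by rw [hκ]; field_simp; norm_num
  have Q3 : δ * C / 2 ≤ ε / 4 := by
    have : δ * (C + 1) = ε / 2 := by rw [hδ]; field_simp
    nlinarith
  rw [hsplit]
  linarith

end WC

namespace WC
open Polynomial
lemma radial (F : ℝ → ENNReal) (hF : Measurable F) :
    ∫⁻ z : ℝ × ℝ, F (z.1^2 + z.2^2) = ENNReal.ofReal Real.pi * ∫⁻ r in Set.Ioi 0, F r := by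
  rw [← lintegral_comp_polarCoord_symm (fun z : ℝ × ℝ => F (z.1^2 + z.2^2))]
  have e : ∀ p : ℝ × ℝ, ENNReal.ofReal p.1 • F ((polarCoord.symm p).1^2 + (polarCoord.symm p).2^2)
      = ENNReal.ofReal p.1 * F (p.1^2) := by
    intro p
    rw [polarCoord_symm_apply, smul_eq_mul]
    congr 2
    simp only
    linear_combination p.1^2 * Real.sin_sq_add_cos_sq p.2
  simp_rw [e]
  rw [polarCoord_target, Measure.volume_eq_prod, ← Measure.prod_restrict,
    lintegral_prod _ (by fun_prop)]
  simp only [lintegral_const, Measure.restrict_apply MeasurableSet.univ, Set.univ_inter,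
    Real.volume_Ioo]
  rw [lintegral_mul_const _ (by fun_prop)]
  have himg : Set.image (fun r : ℝ => r^2) (Set.Ioi 0) = Set.Ioi 0 := by
    ext y; constructor
    · rintro ⟨x, hx, rfl⟩
      exact pow_pos (Set.mem_Ioi.1 hx) 2
    · intro hy
      exact ⟨Real.sqrt y, Real.sqrt_pos.2 hy, Real.sq_sqrt (le_of_lt hy)⟩
  have := lintegral_image_eq_lintegral_abs_deriv_mul (s := Set.Ioi (0:ℝ)) (f := fun r : ℝ => r^2)
    (f' := fun r => 2 * r) measurableSet_Ioi
    (fun x _ => by simpa using (hasDerivAt_pow 2 x).hasDerivWithinAt)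
    (fun x hx y hy h => by
      have hx' : 0 < x := hx
      have hy' : 0 < y := hy
      exact (pow_left_inj₀ hx'.le hy'.le two_ne_zero).1 h) F
  rw [himg] at this
  rw [this]
  have e2 : ∫⁻ r in Set.Ioi (0:ℝ), ENNReal.ofReal |2 * r| * F (r^2) =
      ENNReal.ofReal 2 * ∫⁻ r in Set.Ioi (0:ℝ), ENNReal.ofReal r * F (r^2) := by
    rw [← lintegral_const_mul _ (by fun_prop)]
    refine setLIntegral_congr_fun measurableSet_Ioi fun r hr => ?_
    have hr' : 0 < r := hr
    rw [abs_of_pos (by positivity), ENNReal.ofReal_mul (by norm_num), mul_assoc]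
  rw [e2, ← mul_assoc, ← ENNReal.ofReal_mul Real.pi_pos.le, mul_comm]
  congr 2; ring

lemma radial_bound (f : ℝ → ℝ) (hf : Measurable f) (hfi : IntegrableOn f (Set.Ioi 0))
    (φ : ℝ × ℝ → ℂ) (M : ℝ) (hM : 0 ≤ M) (hφ : ∀ z, ‖φ z‖ ≤ M) :
    ‖∫ z : ℝ × ℝ, ((f (z.1^2 + z.2^2) : ℝ) : ℂ) * φ z‖ ≤
      M * (Real.pi * ∫ r in Set.Ioi 0, |f r|) := by
  have hI : 0 ≤ ∫ r in Set.Ioi 0, |f r| :=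
    setIntegral_nonneg measurableSet_Ioi (fun r _ => abs_nonneg _)
  rw [← ENNReal.ofReal_le_ofReal_iff (by positivity), ofReal_norm]
  refine (enorm_integral_le_lintegral_enorm _).trans ?_
  rw [ENNReal.ofReal_mul hM, ENNReal.ofReal_mul Real.pi_pos.le]
  have := ofReal_integral_norm_eq_lintegral_enorm hfi
  simp only [Real.norm_eq_abs] at this
  rw [this, ← radial _ (by fun_prop), ← lintegral_const_mul _ (by fun_prop)]
  refine lintegral_mono fun z => ?_
  rw [enorm_mul, mul_comm]
  gcongr
  · rw [← ofReal_norm]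
    exact ENNReal.ofReal_le_ofReal (hφ z)
  · rw [← ofReal_norm, ← ofReal_norm, Complex.norm_real]

lemma bdd (φ : ℝ × ℝ → ℂ) (hc : Continuous φ)
    (h0 : Tendsto φ (cocompact (ℝ × ℝ)) (nhds 0)) : ∃ M, 0 ≤ M ∧ ∀ z, ‖φ z‖ ≤ M := by
  let g : ZeroAtInftyContinuousMap (ℝ × ℝ) ℂ := ⟨⟨φ, hc⟩, h0⟩
  exact ⟨‖g.toBCF‖, norm_nonneg _, fun z => g.toBCF.norm_coe_le_norm z⟩

end WC

/-- Weak convergence of the Weyl symbol of `P_{<N}` to the indicator of the disk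
`D = {x² + p² < 2μ}`, tested against any function `φ` in the Lions–Paul class `𝒜`. -/
theorem weak_convergence_sigmaP (μ : ℝ) (hμ : 0 < μ) (φ : ℝ × ℝ → ℂ)
    (hφ_cont : Continuous φ)
    (hφ_zero : Tendsto φ (cocompact (ℝ × ℝ)) (nhds 0))
    (hφ_int : ∀ x : ℝ, Integrable (fun p : ℝ => φ (x, p)))
    (hφ_A : Integrable (fun y : ℝ =>
      ⨆ x : ℝ, ‖∫ p : ℝ, φ (x, p) * Complex.exp (-(Complex.I * (p:ℂ) * (y:ℂ)))‖)) :
    Tendsto (fun N : ℕ =>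
      ∫ z : ℝ × ℝ,
        (sigmaP (μ / N) N z.1 z.2 -
          (if z.1 ^ 2 + z.2 ^ 2 < 2 * μ then (1 : ℂ) else 0)) * φ z)
      atTop (nhds 0) := by
  obtain ⟨M, hM, hb⟩ := WC.bdd φ hφ_cont hφ_zero
  have hT : 0 < 2 * μ := by positivity
  have hh : ∀ n : ℕ, 0 < μ / ((n + 1 : ℕ) : ℝ) := fun n => by positivity
  have hmul : ∀ n : ℕ, μ / ((n + 1 : ℕ) : ℝ) * ((n + 1 : ℕ) : ℝ) = μ := fun n => by
    have : ((n + 1 : ℕ) : ℝ) ≠ 0 := by positivity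
    field_simp
  have hl1 := WC.l1_conv (2 * μ) hT (fun n => WC.S (μ / ((n + 1 : ℕ) : ℝ)) (n + 1)) (9 * μ ^ 3)
    (fun n t ht => WC.S_lap_int _ (hh n) _ t ht)
    (fun t ht => (tendsto_add_atTop_iff_nat 1).2 (WC.S_lap_tendsto μ hμ t ht))
    (fun n => WC.S_sq_int _ (hh n) _)
    (fun n => by rw [WC.S_sq_integral _ (hh n), mul_assoc, hmul])
    (fun n => WC.S_wsq_int _ (hh n) _)
    (fun n => by
      have := WC.S_wsq_integral _ (hh n) (n + 1)
      rwa [hmul] at this)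
  have hlim := (hl1.const_mul Real.pi).const_mul M
  rw [mul_zero, mul_zero] at hlim
  rw [← tendsto_add_atTop_iff_nat 1]
  refine squeeze_zero_norm (fun n => ?_) hlim
  have hmeas : Measurable fun r =>
      WC.S (μ / ((n + 1 : ℕ) : ℝ)) (n + 1) r - WC.chi (2 * μ) r := by
    refine (WC.S_continuous _ _).measurable.sub ?_
    rw [WC.chi_eq_ind]
    exact measurable_const.indicator measurableSet_Iio
  have hIntg : IntegrableOn (fun r =>
      WC.S (μ / ((n + 1 : ℕ) : ℝ)) (n + 1) r - WC.chi (2 * μ) r) (Set.Ioi 0) := by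
    have := WC.S_lap_int _ (hh n) (n + 1) 0 le_rfl
    simp only [zero_mul, neg_zero, Real.exp_zero, mul_one] at this
    exact this.sub (WC.chi_int _)
  refine le_trans (le_of_eq ?_) (WC.radial_bound _ hmeas hIntg φ M hM hb)
  congr 2
  ext z
  rw [WC.sigmaP_eq _ (hh n)]
  simp only [WC.S, WC.chi]
  split_ifs <;> push_cast <;> rfl
end

section
/- Let μ > 0 and for each integer N ≥ 1 set ℏ = ℏ_N := μ/N. Then for every test function φ in the class 𝒜, the limit lim_{N→∞} ∬_{ℝ²} [σ_{H_N}^{ℏ_N}(x,p) − p·χ_D(x,p)] φ(x,p) dx dp = 0 holds. -/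
open MeasureTheory Filter

section PartA
open Polynomial

/-- Physicists' Hermite polynomials as polynomials. -/
noncomputable def HP : ℕ → Polynomial ℝ
  | 0 => 1
  | (k+1) => 2 * X * HP k - derivative (HP k)

theorem HP_deriv (k : ℕ) : derivative (HP k) = C (2 * (k:ℝ)) * HP (k-1) := by
  have key : ∀ k : ℕ, derivative (HP (k+1)) = C (2 * ((k:ℝ)+1)) * HP k := by
    intro k
    induction k with
    | zero => simp [HP, C_ofNat]
    | succ k ih =>
      rw [HP, derivative_sub, derivative_mul, ih, derivative_C_mul]
      rw [show HP (k+1) = 2 * X * HP k - derivative (HP k) from rfl]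
      have : derivative (2 * X : ℝ[X]) = 2 := by simp
      rw [this]
      simp only [map_mul, map_add, C_1, C_ofNat, Nat.cast_add, Nat.cast_one]
      ring
  cases k with
  | zero => simp [HP]
  | succ k => simpa using key k

theorem HP_rec (k : ℕ) : HP (k+1) = 2 * X * HP k - C (2 * (k:ℝ)) * HP (k-1) := by
  rw [← HP_deriv]; rfl

theorem hermiteH_eq (k : ℕ) (y : ℝ) : hermiteH k y = (HP k).eval y := by
  have key : ∀ k : ℕ, iteratedDeriv k (fun t : ℝ => Real.exp (-t^2)) =
      fun t => (-1)^k * (HP k).eval t * Real.exp (-t^2) := by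
    intro k
    induction k with
    | zero => simp [HP]
    | succ k ih =>
      rw [iteratedDeriv_succ, ih]
      funext t
      have h1 : HasDerivAt (fun t : ℝ => Real.exp (-t^2)) (Real.exp (-t^2) * (-(2*t))) t := by
        have := ((hasDerivAt_pow 2 t).neg).exp
        simpa using this
      have h2 := ((((HP k).hasDerivAt t).const_mul ((-1:ℝ)^k)).mul h1).deriv
      refine (Eq.trans ?_ h2).trans ?_
      · rfl
      · simp [HP]; ring
  rw [hermiteH, key]
  have h1 : ((-1:ℝ)^k) * (-1)^k = 1 := by rw [← mul_pow]; simp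
  have h2 : Real.exp (y^2) * Real.exp (-y^2) = 1 := by rw [← Real.exp_add]; simp
  calc _ = ((-1:ℝ)^k * (-1)^k) * (Real.exp (y^2) * Real.exp (-y^2)) * (HP k).eval y := by ring
    _ = _ := by rw [h1, h2]; ring

theorem gauss_integrable (P : ℝ) (q : ℂ[X]) :
    Integrable (fun y : ℝ => q.eval (y:ℂ) * Complex.exp (-(y:ℂ)^2/4 + Complex.I * P * y)) := by
  induction q using Polynomial.induction_on' with
  | add p q hp hq =>
    simp only [eval_add, add_mul]
    exact hp.add hq
  | monomial n a =>
    have h := (integrable_rpow_mul_exp_neg_mul_sq (b := 1/4) (by norm_num) (s := n)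
      (by have : (0:ℝ) ≤ n := Nat.cast_nonneg n
          linarith)).norm.const_mul ‖a‖
    refine h.mono' ?_ (ae_of_all _ fun y => ?_)
    · apply Continuous.aestronglyMeasurable
      fun_prop
    · rw [eval_monomial, norm_mul, norm_mul, norm_mul, Complex.norm_exp, norm_pow, Complex.norm_real,
        Real.rpow_natCast, norm_pow, mul_assoc]
      have : (-(y:ℂ)^2/4 + Complex.I * P * y).re = -(1/4) * y^2 := by
        simp [pow_two]; ring
      rw [this, Real.norm_of_nonneg (Real.exp_pos _).le]

noncomputable def gInt (P : ℝ) (q : ℂ[X]) : ℂ :=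
  ∫ y : ℝ, q.eval (y:ℂ) * Complex.exp (-(y:ℂ)^2/4 + Complex.I * P * y)

theorem gInt_add (P : ℝ) (p q : ℂ[X]) : gInt P (p + q) = gInt P p + gInt P q := by
  simp only [gInt, eval_add, add_mul]
  exact integral_add (gauss_integrable P p) (gauss_integrable P q)

theorem gInt_C_mul (P : ℝ) (a : ℂ) (q : ℂ[X]) : gInt P (C a * q) = a * gInt P q := by
  simp only [gInt, eval_mul, eval_C, mul_assoc]
  exact integral_const_mul _ _

theorem gInt_X_mul (P : ℝ) (q : ℂ[X]) :
    gInt P (X * q) = 2 * Complex.I * P * gInt P q + 2 * gInt P (derivative q) := by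
  have h : gInt P (derivative q + (C (-1/2) * (X * q) + C (Complex.I * P) * q)) = 0 := by
    refine integral_eq_zero_of_hasDerivAt_of_integrable (f := fun y : ℝ => q.eval (y:ℂ) *
      Complex.exp (-(y:ℂ)^2/4 + Complex.I * P * y)) (fun y => ?_) (gauss_integrable P _)
      (gauss_integrable P q)
    have h1 : HasDerivAt (fun z : ℂ => Complex.exp (-z^2/4 + Complex.I * P * z))
        (Complex.exp (-(y:ℂ)^2/4 + Complex.I * P * y) * (-(2 * (y:ℂ))/4 + Complex.I * P)) (y:ℂ) := by
      have := ((((hasDerivAt_pow 2 (y:ℂ)).neg).div_const 4).add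
        ((hasDerivAt_id (y:ℂ)).const_mul (Complex.I * P))).cexp
      simpa using this
    have h2 := ((q.hasDerivAt (y:ℂ)).mul h1).comp_ofReal
    refine h2.congr_deriv ?_
    simp; ring
  rw [gInt_add, gInt_add, gInt_C_mul, gInt_C_mul] at h
  linear_combination (-2) * h

theorem gInt_one (P : ℝ) : gInt P 1 = 2 * Real.sqrt Real.pi * Real.exp (-P^2) := by
  have h := integral_cexp_quadratic (b := -1/4) (by norm_num) (Complex.I * P) 0
  have h2 : gInt P 1 = ∫ x : ℝ, Complex.exp (-1/4 * (x:ℂ)^2 + Complex.I * P * x + 0) := by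
    simp only [gInt, eval_one, one_mul]
    congr 1; ext x; congr 1; ring
  rw [h2, h]
  have h3 : ((Real.pi:ℂ) / -(-1/4)) ^ (1/2 : ℂ) = 2 * Real.sqrt Real.pi := by
    have : ((Real.pi:ℂ) / -(-1/4)) = ((4 * Real.pi : ℝ) : ℂ) := by push_cast; ring
    rw [this, show (1/2:ℂ) = ((1/2:ℝ):ℂ) by norm_num, ← Complex.ofReal_cpow (by positivity),
      ← Real.sqrt_eq_rpow, Real.sqrt_mul (by norm_num), show (4:ℝ) = 2^2 by norm_num,
      Real.sqrt_sq (by norm_num)]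
    push_cast; ring
  rw [h3, Complex.ofReal_exp]
  congr 2
  have : (Complex.I * P)^2 = -(P:ℂ)^2 := by rw [mul_pow, Complex.I_sq]; ring
  rw [this]; push_cast; ring

noncomputable def HC (k : ℕ) : ℂ[X] := (HP k).map Complex.ofRealHom

theorem HC_rec (k : ℕ) : HC (k+1) = 2 * X * HC k - C (2 * (k:ℂ)) * HC (k-1) := by
  simp [HC, HP_rec k]

theorem HC_deriv (k : ℕ) : derivative (HC k) = C (2 * (k:ℂ)) * HC (k-1) := by
  rw [HC, derivative_map, HP_deriv]; simp [HC]

noncomputable def WP (x : ℝ) (j k : ℕ) : ℂ[X] :=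
  (HC j).comp (C (x:ℂ) - C (1/2) * X) * (HC k).comp (C (x:ℂ) + C (1/2) * X)

theorem WP_right (x : ℝ) (j k : ℕ) :
    WP x j (k+1) = C (2 * (x:ℂ)) * WP x j k + (X * WP x j k + C (-(2 * (k:ℂ))) * WP x j (k-1)) := by
  simp only [WP, HC_rec k, sub_comp, mul_comp, C_comp, X_comp, ofNat_comp]
  have : (C (1/2:ℂ)) * 2 = 1 := by
    rw [← C_ofNat, ← C_mul]; norm_num
  simp only [C_mul, C_neg, C_ofNat]
  linear_combination (HC j).comp (C (x:ℂ) - C (1/2) * X) * X * (HC k).comp (C (x:ℂ) + C (1/2) * X) * this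

theorem WP_left (x : ℝ) (j k : ℕ) :
    WP x (j+1) k = C (2 * (x:ℂ)) * WP x j k + (C (-1) * (X * WP x j k) + C (-(2 * (j:ℂ))) * WP x (j-1) k) := by
  simp only [WP, HC_rec j, sub_comp, mul_comp, C_comp, X_comp, ofNat_comp]
  have : (C (1/2:ℂ)) * 2 = 1 := by
    rw [← C_ofNat, ← C_mul]; norm_num
  simp only [C_mul, C_neg, C_ofNat, C_1]
  linear_combination -(HC j).comp (C (x:ℂ) - C (1/2) * X) * X * (HC k).comp (C (x:ℂ) + C (1/2) * X) * this

theorem WP_deriv (x : ℝ) (j k : ℕ) :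
    derivative (WP x j k) = C (-(j:ℂ)) * WP x (j-1) k + C (k:ℂ) * WP x j (k-1) := by
  have : (C (1/2:ℂ)) * 2 = 1 := by
    rw [← C_ofNat, ← C_mul]; norm_num
  simp only [WP, derivative_mul, derivative_comp, HC_deriv, derivative_sub, derivative_add,
    derivative_C, derivative_X, mul_comp, C_comp, C_mul, C_neg, C_ofNat, ofNat_comp]
  linear_combination (-(C (j:ℂ)) * (HC (j-1)).comp (C (x:ℂ) - C (1/2) * X) * (HC k).comp (C (x:ℂ) + C (1/2) * X)
    + (C (k:ℂ)) * (HC (k-1)).comp (C (x:ℂ) + C (1/2) * X) * (HC j).comp (C (x:ℂ) - C (1/2) * X)) * this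

noncomputable def wq (x P : ℝ) (j k : ℕ) : ℂ := gInt P (WP x j k)

theorem wq_right (x P : ℝ) (j k : ℕ) :
    wq x P j (k+1) = 2 * (x + Complex.I * P) * wq x P j k - 2 * j * wq x P (j-1) k := by
  simp only [wq]
  rw [WP_right, gInt_add, gInt_add, gInt_C_mul, gInt_C_mul, gInt_X_mul, WP_deriv, gInt_add,
    gInt_C_mul, gInt_C_mul]
  ring

theorem wq_left (x P : ℝ) (j k : ℕ) :
    wq x P (j+1) k = 2 * (x - Complex.I * P) * wq x P j k - 2 * k * wq x P j (k-1) := by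
  simp only [wq]
  rw [WP_left, gInt_add, gInt_add, gInt_C_mul, gInt_C_mul, gInt_C_mul, gInt_X_mul, WP_deriv, gInt_add,
    gInt_C_mul, gInt_C_mul]
  ring

theorem wq_zero (x P : ℝ) : wq x P 0 0 = 2 * Real.sqrt Real.pi * Real.exp (-P^2) := by
  rw [← gInt_one]; simp [wq, WP, HC, HP]

/-- Laguerre polynomials `(L_j, L_j^{(1)})` -/
noncomputable def pAB : ℕ → Polynomial ℝ × Polynomial ℝ
  | 0 => (1, 1)
  | (j+1) => ((pAB j).1 - C (1/((j:ℝ)+1)) * X * (pAB j).2,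
      ((pAB j).1 - C (1/((j:ℝ)+1)) * X * (pAB j).2) + (pAB j).2)

noncomputable def pA (j : ℕ) : Polynomial ℝ := (pAB j).1
noncomputable def pB (j : ℕ) : Polynomial ℝ := (pAB j).2

theorem pA_zero : pA 0 = 1 := rfl
theorem pB_zero : pB 0 = 1 := rfl
theorem pB_succ (j : ℕ) : pB (j+1) = pA (j+1) + pB j := rfl
theorem pA_succ' (j : ℕ) : pA (j+1) = pA j - C (1/((j:ℝ)+1)) * X * pB j := rfl
theorem pA_succ (j : ℕ) : C ((j:ℝ)+1) * (pA (j+1) - pA j) = - X * pB j := by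
  have : C ((j:ℝ)+1) * C (1/((j:ℝ)+1)) = 1 := by
    rw [← C_mul, ← C_1]; congr 1; field_simp
  rw [pA_succ']
  linear_combination (-X * pB j) * this

theorem wq_closed (x P : ℝ) (j : ℕ) :
    wq x P j j = wq x P 0 0 * (-2)^j * (j.factorial) * ((pA j).eval (2*(x^2+P^2)) : ℝ) ∧
    wq x P j (j+1) = wq x P 0 0 * (-2)^j * (j.factorial) * (2 * (x + Complex.I * P)) *
      ((pB j).eval (2*(x^2+P^2)) : ℝ) ∧
    wq x P (j+1) j = wq x P 0 0 * (-2)^j * (j.factorial) * (2 * (x - Complex.I * P)) *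
      ((pB j).eval (2*(x^2+P^2)) : ℝ) := by
  induction j with
  | zero =>
    refine ⟨by simp [pA_zero], ?_, ?_⟩
    · rw [wq_right]; simp [pB_zero]; ring
    · rw [wq_left]; simp [pB_zero]; ring
  | succ j ih =>
    obtain ⟨h1, h2, h3⟩ := ih
    have hj : ((j:ℂ)+1) ≠ 0 := by exact_mod_cast Nat.succ_ne_zero j
    have hA : (((pA (j+1)).eval (2*(x^2+P^2)) : ℝ) : ℂ) * (j+1) = (((pA j).eval (2*(x^2+P^2)) : ℝ) : ℂ) * (j+1)
        - (2*((x:ℂ)^2+P^2)) * (((pB j).eval (2*(x^2+P^2)) : ℝ) : ℂ) := by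
      have := congrArg (fun q => ((q.eval (2*(x^2+P^2)) : ℝ) : ℂ)) (pA_succ j)
      simp only [eval_mul, eval_sub, eval_C, eval_neg, eval_X] at this
      push_cast at this
      linear_combination this
    have hB : (((pB (j+1)).eval (2*(x^2+P^2)) : ℝ) : ℂ) = (((pA (j+1)).eval (2*(x^2+P^2)) : ℝ) : ℂ)
        + (((pB j).eval (2*(x^2+P^2)) : ℝ) : ℂ) := by
      rw [pB_succ]; simp
    have hI : Complex.I^2 = -1 := Complex.I_sq
    have hd : wq x P (j+1) (j+1) = wq x P 0 0 * (-2)^(j+1) * ((j+1).factorial) * ((pA (j+1)).eval (2*(x^2+P^2)) : ℝ) := by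
      rw [wq_left]
      simp only [Nat.add_sub_cancel]
      rw [h2, h1, Nat.factorial_succ]
      push_cast
      linear_combination (-2) * wq x P 0 0 * (-2)^j * (-(j.factorial:ℂ)) * hA - 4 * wq x P 0 0 * (-2)^j * (j.factorial:ℂ) * (((pB j).eval (2*(x^2+P^2)) : ℝ) : ℂ) * P^2 * hI
    refine ⟨hd, ?_, ?_⟩
    · rw [wq_right, hd]
      simp only [Nat.add_sub_cancel]
      rw [h2, hB, Nat.factorial_succ]
      push_cast; ring
    · rw [wq_left, hd]
      simp only [Nat.add_sub_cancel]
      rw [h3, hB, Nat.factorial_succ]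
      push_cast; ring

end PartA

section PartC
open Polynomial

noncomputable def cnH (h : ℝ) (k : ℕ) : ℝ :=
  (Real.sqrt (Real.sqrt Real.pi * 2^k * (Nat.factorial k) * Real.sqrt h))⁻¹

theorem psi_prod (h : ℝ) (hh : 0 < h) (x p : ℝ) (j k : ℕ) (y : ℝ) :
    ((psiH h j (x - h*y/2) * psiH h k (x + h*y/2) : ℝ) : ℂ) * Complex.exp (Complex.I * (p:ℂ) * (y:ℂ)) =
    ((cnH h j * cnH h k * Real.exp (-(x/Real.sqrt h)^2) : ℝ) : ℂ) *
      ((WP (x/Real.sqrt h) j k).eval ((Real.sqrt h * y : ℝ):ℂ) *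
        Complex.exp (-((Real.sqrt h * y : ℝ):ℂ)^2/4 + Complex.I * (p/Real.sqrt h : ℝ) * (Real.sqrt h * y : ℝ))) := by
  set r := Real.sqrt h with hr
  have hrpos : 0 < r := Real.sqrt_pos.2 hh
  have hrr : h = r^2 := (Real.sq_sqrt hh.le).symm
  have e1 : (WP (x/r) j k).eval ((r * y : ℝ):ℂ) =
      (((HP j).eval ((x - h*y/2)/r) * (HP k).eval ((x + h*y/2)/r) : ℝ) : ℂ) := by
    simp only [WP, HC, eval_mul, eval_comp, eval_add, eval_sub, eval_C, eval_X]
    have a1 : (((x/r : ℝ):ℂ) - 1/2 * ((r * y : ℝ):ℂ)) = (((x - h*y/2)/r : ℝ) : ℂ) := by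
      rw [show (x - h*y/2)/r = x/r - 1/2*(r*y) by rw [hrr]; field_simp]
      push_cast; ring
    have a2 : (((x/r : ℝ):ℂ) + 1/2 * ((r * y : ℝ):ℂ)) = (((x + h*y/2)/r : ℝ) : ℂ) := by
      rw [show (x + h*y/2)/r = x/r + 1/2*(r*y) by rw [hrr]; field_simp]
      push_cast; ring
    rw [a1, a2, Complex.ofReal_mul]
    congr 1 <;> exact Polynomial.eval_map_apply (f := Complex.ofRealHom) _
  have e2 : Complex.exp (-((r * y : ℝ):ℂ)^2/4 + Complex.I * (p/r : ℝ) * (r * y : ℝ)) =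
      (Real.exp (-(r*y)^2/4) : ℂ) * Complex.exp (Complex.I * (p:ℂ) * (y:ℂ)) := by
    rw [Complex.ofReal_exp, ← Complex.exp_add]
    congr 1
    have : (r:ℂ) ≠ 0 := by exact_mod_cast hrpos.ne'
    push_cast; field_simp
  rw [e1, e2]
  have e3 : Real.exp (-(x - h*y/2)^2/(2*h)) * Real.exp (-(x + h*y/2)^2/(2*h)) =
      Real.exp (-(x/r)^2) * Real.exp (-(r*y)^2/4) := by
    rw [← Real.exp_add, ← Real.exp_add, hrr]; congr 1; field_simp; ring
  have e4 : psiH h j (x - h*y/2) * psiH h k (x + h*y/2) =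
      cnH h j * cnH h k * Real.exp (-(x/r)^2) * ((HP j).eval ((x - h*y/2)/r) * (HP k).eval ((x + h*y/2)/r)
        * Real.exp (-(r*y)^2/4)) := by
    rw [psiH, psiH, hermiteH_eq, hermiteH_eq]
    simp only [cnH]
    rw [← hr]
    linear_combination ((√(√Real.pi * 2 ^ j * (j.factorial) * r))⁻¹ * (√(√Real.pi * 2 ^ k * (k.factorial) * r))⁻¹ * eval ((x - h * y / 2) / r) (HP j) * eval ((x + h * y / 2) / r) (HP k)) * e3
  rw [e4]
  push_cast
  ring

theorem psi_integrable (h : ℝ) (hh : 0 < h) (x p : ℝ) (j k : ℕ) :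
    Integrable (fun y : ℝ => ((psiH h j (x - h*y/2) * psiH h k (x + h*y/2) : ℝ) : ℂ) *
      Complex.exp (Complex.I * (p:ℂ) * (y:ℂ))) := by
  simp only [psi_prod h hh]
  exact ((gauss_integrable (p/Real.sqrt h) (WP (x/Real.sqrt h) j k)).comp_mul_left'
    (Real.sqrt_pos.2 hh).ne').const_mul _

theorem psi_integral (h : ℝ) (hh : 0 < h) (x p : ℝ) (j k : ℕ) :
    ∫ y : ℝ, ((psiH h j (x - h*y/2) * psiH h k (x + h*y/2) : ℝ) : ℂ) *
      Complex.exp (Complex.I * (p:ℂ) * (y:ℂ)) =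
    ((cnH h j * cnH h k * Real.exp (-(x/Real.sqrt h)^2) * (Real.sqrt h)⁻¹ : ℝ) : ℂ) *
      wq (x/Real.sqrt h) (p/Real.sqrt h) j k := by
  simp only [psi_prod h hh]
  rw [integral_const_mul]
  have := Measure.integral_comp_mul_left (fun y : ℝ => (WP (x/Real.sqrt h) j k).eval (y:ℂ) *
        Complex.exp (-(y:ℂ)^2/4 + Complex.I * (p/Real.sqrt h : ℝ) * y)) (Real.sqrt h)
  rw [this, abs_of_pos (inv_pos.2 (Real.sqrt_pos.2 hh)), Complex.real_smul, wq, gInt]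
  push_cast; ring

noncomputable def pS (n : ℕ) : ℝ[X] := ∑ j ∈ Finset.range n, C ((-1:ℝ)^j) * pB j

theorem cn_prod (h : ℝ) (hh : 0 < h) (j : ℕ) :
    cnH h (j+1) * cnH h j * (Real.sqrt Real.pi * 2^j * j.factorial * Real.sqrt h * Real.sqrt 2 * Real.sqrt ((j:ℝ)+1)) = 1 := by
  have hr : 0 < Real.sqrt h := Real.sqrt_pos.2 hh
  have hpi : 0 < Real.sqrt Real.pi := Real.sqrt_pos.2 Real.pi_pos
  set c := Real.sqrt Real.pi * 2^j * j.factorial * Real.sqrt h with hc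
  have hcp : 0 < c := by positivity
  have h1 : cnH h (j+1) = (Real.sqrt (c * (2 * ((j:ℝ)+1))))⁻¹ := by
    rw [cnH, Nat.factorial_succ, hc]; congr 2; push_cast; ring
  have h2 : cnH h j = (Real.sqrt c)⁻¹ := rfl
  have h3 : Real.sqrt (c * (2 * ((j:ℝ)+1))) = Real.sqrt c * (Real.sqrt 2 * Real.sqrt ((j:ℝ)+1)) := by
    rw [Real.sqrt_mul hcp.le (2 * ((j:ℝ)+1)), Real.sqrt_mul (show (0:ℝ) ≤ 2 by norm_num) ((j:ℝ)+1)]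
  have h4 : Real.sqrt c * Real.sqrt c = c := Real.mul_self_sqrt hcp.le
  rw [h1, h2, h3]
  have : 0 < Real.sqrt c := Real.sqrt_pos.2 hcp
  have : 0 < Real.sqrt ((j:ℝ)+1) := Real.sqrt_pos.2 (by positivity)
  field_simp
  linarith

theorem sigmaH_eq (h : ℝ) (hh : 0 < h) (N : ℕ) (x p : ℝ) :
    sigmaH h N x p = ((4 * p * Real.exp (-((x^2+p^2)/h)) * (pS (N-1)).eval (2*(x^2+p^2)/h) : ℝ) : ℂ) := by
  have hr : 0 < Real.sqrt h := Real.sqrt_pos.2 hh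
  have hrr : Real.sqrt h ^ 2 = h := Real.sq_sqrt hh.le
  have e0 : sigmaH h N x p = ∫ y : ℝ, ∑ j ∈ Finset.range (N-1),
      (h : ℂ) * Complex.I * (Real.sqrt (h/2) : ℂ) * ((Real.sqrt ((j:ℝ)+1) : ℝ) : ℂ) *
      (((psiH h (j+1) (x - h*y/2) * psiH h j (x + h*y/2) : ℝ) : ℂ) * Complex.exp (Complex.I * (p:ℂ) * (y:ℂ))
      - ((psiH h j (x - h*y/2) * psiH h (j+1) (x + h*y/2) : ℝ) : ℂ) * Complex.exp (Complex.I * (p:ℂ) * (y:ℂ))) := by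
    rw [sigmaH]; congr 1; ext y
    rw [KerQ, Finset.mul_sum, Finset.mul_sum, Finset.sum_mul]
    apply Finset.sum_congr rfl
    intro j _
    push_cast; ring
  rw [e0, integral_finsetSum]
  swap
  · intro j _
    exact ((psi_integrable h hh x p _ _).sub (psi_integrable h hh x p _ _)).const_mul _
  rw [pS, eval_finsetSum, Finset.mul_sum, Complex.ofReal_sum]
  apply Finset.sum_congr rfl
  intro j _
  rw [integral_const_mul, integral_sub (psi_integrable h hh x p _ _) (psi_integrable h hh x p _ _),
    psi_integral h hh, psi_integral h hh, (wq_closed _ _ j).2.1, (wq_closed _ _ j).2.2, wq_zero]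
  have e1 : 2 * ((x/Real.sqrt h)^2 + (p/Real.sqrt h)^2) = 2*(x^2+p^2)/h := by
    rw [div_pow, div_pow, hrr]; ring
  rw [e1, eval_mul, eval_C]
  set b := (pB j).eval (2*(x^2+p^2)/h) with hb
  have e2 : Real.exp (-(x/Real.sqrt h)^2) * Real.exp (-(p/Real.sqrt h)^2) = Real.exp (-((x^2+p^2)/h)) := by
    rw [← Real.exp_add, div_pow, div_pow, hrr]; congr 1; ring
  have e3 := cn_prod h hh j
  have e4 : Real.sqrt (h/2) * Real.sqrt 2 = Real.sqrt h := by
    rw [← Real.sqrt_mul (by positivity)]; congr 1; ring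
  have e5 : Real.sqrt 2 * Real.sqrt 2 = 2 := Real.mul_self_sqrt (by norm_num)
  have e6 : (-2:ℝ)^j = (-1)^j * 2^j := by rw [← mul_pow]; norm_num
  set r := Real.sqrt h with hrdef
  have key : 4 * p * Real.exp (-((x^2+p^2)/h)) * ((-1)^j * b) =
      h * Real.sqrt (h/2) * Real.sqrt ((j:ℝ)+1) * (cnH h (j+1) * cnH h j * Real.exp (-(x/r)^2) * r⁻¹) *
        (2 * Real.sqrt Real.pi * Real.exp (-(p/r)^2) * (-2)^j * j.factorial * (4 * (p/r)) * b) := by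
    rw [← e2, e6]
    have e7 : Real.sqrt (h/2) = r * Real.sqrt 2 / 2 := by
      rw [← e4]; linear_combination (-Real.sqrt (h/2)/2) * e5
    rw [e7]
    have : h * r⁻¹ * (p/r) = p := by rw [← hrr]; field_simp
    linear_combination (-4) * Real.exp (-(x/r)^2) * Real.exp (-(p/r)^2) * ((-1)^j * b) * p * e3 - 4 * Real.exp (-(x/r)^2) * Real.exp (-(p/r)^2) * ((-1)^j * b) * (cnH h (j+1) * cnH h j * (√Real.pi * 2^j * j.factorial * r * √2 * √((j:ℝ)+1))) * this
  rw [key]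
  have hI : Complex.I^2 = -1 := Complex.I_sq
  push_cast
  linear_combination (-(h:ℂ) * (√(h/2):ℂ) * (√((j:ℝ)+1):ℂ) * ((cnH h (j+1):ℂ) * cnH h j * Complex.exp (-((x:ℂ)/r)^2) * (r:ℂ)⁻¹) *
        (2 * (√Real.pi:ℂ) * Complex.exp (-((p:ℂ)/r)^2) * (-2)^j * j.factorial * (4 * ((p:ℂ)/r)) * b)) * hI

end PartC

section PartD
open Polynomial

theorem Lf_int (s : ℝ) (hs : 0 < s) (q : ℝ[X]) :
    IntegrableOn (fun t : ℝ => q.eval t * Real.exp (-(s*t))) (Set.Ioi 0) := by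
  induction q using Polynomial.induction_on' with
  | add p q hp hq =>
    simp only [eval_add, add_mul]
    exact hp.add hq
  | monomial n a =>
    have h := (integrableOn_rpow_mul_exp_neg_mul_rpow (p := 1) (s := n) (b := s)
      (by have : (0:ℝ) ≤ n := Nat.cast_nonneg n
          linarith) one_pos hs).const_mul a
    refine IntegrableOn.congr_fun h (fun t _ => ?_) measurableSet_Ioi
    simp [eval_monomial, mul_assoc]

noncomputable def Lf (s : ℝ) (q : ℝ[X]) : ℝ :=
  ∫ t in Set.Ioi (0:ℝ), q.eval t * Real.exp (-(s*t))

theorem Lf_add (s : ℝ) (hs : 0 < s) (p q : ℝ[X]) : Lf s (p + q) = Lf s p + Lf s q := by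
  simp only [Lf, eval_add, add_mul]
  exact integral_add (Lf_int s hs p) (Lf_int s hs q)

theorem Lf_C_mul (s : ℝ) (a : ℝ) (q : ℝ[X]) : Lf s (C a * q) = a * Lf s q := by
  simp only [Lf, eval_mul, eval_C, mul_assoc]
  exact integral_const_mul _ _

theorem Lf_sub (s : ℝ) (hs : 0 < s) (p q : ℝ[X]) : Lf s (p - q) = Lf s p - Lf s q := by
  have : p - q = p + C (-1) * q := by simp [sub_eq_add_neg]
  rw [this, Lf_add s hs, Lf_C_mul]; ring

theorem Lf_zero (s : ℝ) : Lf s 0 = 0 := by simp [Lf]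

theorem Lf_sum (s : ℝ) (hs : 0 < s) (n : ℕ) (f : ℕ → ℝ[X]) :
    Lf s (∑ j ∈ Finset.range n, f j) = ∑ j ∈ Finset.range n, Lf s (f j) := by
  induction n with
  | zero => simp [Lf_zero]
  | succ n ih => rw [Finset.sum_range_succ, Finset.sum_range_succ, Lf_add s hs, ih]

theorem Lf_pow (s : ℝ) (hs : 0 < s) (n : ℕ) : Lf s (X^n) = n.factorial / s^(n+1) := by
  have h := Real.integral_rpow_mul_exp_neg_mul_Ioi (a := n+1) (r := s) (by positivity) hs
  rw [Real.Gamma_nat_eq_factorial] at h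
  rw [Lf]
  simp only [add_sub_cancel_right, Real.rpow_natCast] at h
  simp only [eval_pow, eval_X]
  rw [h, show ((n:ℝ)+1) = ((n+1:ℕ):ℝ) by push_cast; ring, Real.rpow_natCast, one_div, inv_pow]
  field_simp

theorem Lf_deriv (s : ℝ) (hs : 0 < s) (q : ℝ[X]) :
    Lf s (derivative q) = s * Lf s q - q.eval 0 := by
  induction q using Polynomial.induction_on' with
  | add p q hp hq =>
    rw [derivative_add, Lf_add s hs, Lf_add s hs, hp, hq, eval_add]; ring
  | monomial n a =>
    rw [← C_mul_X_pow_eq_monomial, derivative_C_mul, Lf_C_mul, Lf_C_mul, Lf_pow s hs]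
    cases n with
    | zero => simp [Lf_zero]; field_simp; ring
    | succ n =>
      rw [derivative_X_pow, Lf_C_mul]
      simp only [Nat.add_sub_cancel]
      rw [Lf_pow s hs, Nat.factorial_succ]
      simp
      field_simp
      ring

theorem C_succ_cancel (j : ℕ) (p q : ℝ[X]) (h : C ((j:ℝ)+1) * p = C ((j:ℝ)+1) * q) : p = q := by
  refine mul_left_cancel₀ ?_ h
  rw [Ne, C_eq_zero]; positivity

theorem pAB_deriv (j : ℕ) : derivative (pA (j+1)) = - pB j ∧ derivative (X * pB j) = C ((j:ℝ)+1) * pA j := by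
  have hd : ∀ j : ℕ, derivative (X * pB j) = C ((j:ℝ)+1) * pA j →
      derivative (pA (j+1)) = derivative (pA j) - pA j := by
    intro j h
    apply C_succ_cancel j
    have := congrArg derivative (pA_succ j)
    rw [derivative_C_mul, derivative_sub, neg_mul, derivative_neg, h] at this
    linear_combination this
  induction j with
  | zero =>
    have h0 : derivative (X * pB 0) = C (((0:ℕ):ℝ)+1) * pA 0 := by simp [pB_zero, pA_zero]
    refine ⟨?_, h0⟩
    rw [hd 0 h0]; simp [pB_zero, pA_zero]
  | succ j ih =>
    obtain ⟨h1, h2⟩ := ih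
    have h3 : derivative (X * pB (j+1)) = C (((j+1:ℕ):ℝ)+1) * pA (j+1) := by
      rw [pB_succ, mul_add, derivative_add, h2, derivative_mul, h1, derivative_X]
      have := pA_succ j
      simp only [C_add, C_1, Nat.cast_add, Nat.cast_one] at this ⊢
      linear_combination -this
    refine ⟨?_, h3⟩
    rw [hd (j+1) h3, h1, pB_succ]; ring

theorem pA_eval_zero (j : ℕ) : (pA j).eval 0 = 1 := by
  induction j with
  | zero => simp [pA_zero]
  | succ j ih => rw [pA_succ']; simp [ih]

theorem Lf_pA (s : ℝ) (hs : 0 < s) (j : ℕ) : Lf s (pA j) = (1 - 1/s)^j / s := by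
  induction j with
  | zero =>
    have := Lf_pow s hs 0
    simp at this
    simp [pA_zero, this]
  | succ j ih =>
    have hd : derivative (pA (j+1)) = derivative (pA j) - pA j := by
      rw [(pAB_deriv j).1]
      cases j with
      | zero => simp [pA_zero, pB_zero]
      | succ j => rw [(pAB_deriv j).1, pB_succ]; ring
    have h1 := congrArg (Lf s) hd
    rw [Lf_sub s hs, Lf_deriv s hs, Lf_deriv s hs, pA_eval_zero, pA_eval_zero, ih] at h1
    have : Lf s (pA (j+1)) = (s * ((1 - 1/s)^j/s) - (1-1/s)^j/s) / s := by
      field_simp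
      field_simp at h1
      linarith
    rw [this, pow_succ]; field_simp

theorem Lf_XpB (s : ℝ) (hs : 0 < s) (j : ℕ) :
    Lf s (X * pB j) = (j+1) * (1 - 1/s)^j / s^2 := by
  have h := congrArg (Lf s) (pA_succ j)
  rw [Lf_C_mul, Lf_sub s hs, Lf_pA s hs, Lf_pA s hs] at h
  have h2 : Lf s (-X * pB j) = - Lf s (X * pB j) := by
    have := Lf_C_mul s (-1) (X * pB j)
    rw [← neg_one_mul (Lf s _), ← this]; congr 1; simp
  rw [h2] at h
  rw [← neg_eq_iff_eq_neg.2 h, pow_succ]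
  field_simp
  ring

theorem pB_three (j : ℕ) : X * pB (j+1) = C (-((j:ℝ)+2)) * (pB (j+2) - 2 * pB (j+1) + pB j) := by
  have h := pA_succ (j+1)
  have h1 := pB_succ j
  have h2 := pB_succ (j+1)
  have : pB (j+2) - 2 * pB (j+1) + pB j = pA (j+1+1) - pA (j+1) := by
    linear_combination h2 - h1
  rw [this, C_neg]
  have e : C (((j+1:ℕ):ℝ)+1) = C ((j:ℝ)+2) := by congr 1; push_cast; ring
  rw [e] at h
  linear_combination h

theorem pB_three_zero : X * pB 0 = C (-1) * (pB 1 - 2 * pB 0) := by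
  have h := pA_succ 0
  have h1 := pB_succ 0
  have : pB 1 - 2 * pB 0 = pA 1 - pA 0 := by
    rw [pA_zero, pB_zero] at *; linear_combination h1
  rw [this]
  simp only [C_neg, C_1, Nat.cast_zero, zero_add] at h ⊢
  linear_combination h

noncomputable def MM (j k : ℕ) : ℝ := Lf 1 (X * (pB j * pB k))

theorem Lf_expand (a : ℝ) (p q r m : ℝ[X]) :
    Lf 1 (X * ((C a * (p - 2 * q + r)) * m)) =
      a * (Lf 1 (X * (p * m)) - 2 * Lf 1 (X * (q * m)) + Lf 1 (X * (r * m))) := by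
  have : X * ((C a * (p - 2 * q + r)) * m) = C a * ((X * (p*m) - C 2 * (X * (q * m))) + X * (r * m)) := by
    rw [C_ofNat]; ring
  rw [this, Lf_C_mul, Lf_add 1 one_pos, Lf_sub 1 one_pos, Lf_C_mul]

theorem MM_rec (j k : ℕ) : Lf 1 (X * ((X * pB j) * pB k)) =
    -((j:ℝ)+1) * (MM (j+1) k - 2 * MM j k + (if j = 0 then 0 else MM (j-1) k)) := by
  cases j with
  | zero =>
    have : X * pB 0 = C (-1) * (pB 1 - 2 * pB 0 + 0) := by rw [pB_three_zero]; simp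
    rw [this, Lf_expand]
    simp [MM, Lf_zero]
  | succ j =>
    rw [pB_three, Lf_expand]
    simp only [MM, Nat.succ_ne_zero, if_false, Nat.add_sub_cancel]
    push_cast; ring

theorem MM_symm (j k : ℕ) : MM j k = MM k j := by rw [MM, MM, mul_comp_comm_aux]
  where mul_comp_comm_aux : pB j * pB k = pB k * pB j := mul_comm _ _

theorem MM_rec2 (j k : ℕ) :
    ((j:ℝ)+1) * (MM (j+1) k - 2 * MM j k + (if j = 0 then 0 else MM (j-1) k)) =
    ((k:ℝ)+1) * (MM j (k+1) - 2 * MM j k + (if k = 0 then 0 else MM j (k-1))) := by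
  have h1 := MM_rec j k
  have h2 := MM_rec k j
  have e : X * ((X * pB j) * pB k) = X * ((X * pB k) * pB j) := by ring
  rw [e, h2] at h1
  rw [MM_symm j (k+1), MM_symm j (k-1), MM_symm j k] at *
  linarith

theorem MM_zero (j : ℕ) : MM j 0 = if j = 0 then 1 else 0 := by
  rw [MM, pB_zero, mul_one, Lf_XpB 1 one_pos]
  cases j <;> simp

theorem MM_eq (k : ℕ) : ∀ j, MM j k = if j = k then (k:ℝ)+1 else 0 := by
  induction k using Nat.strong_induction_on with
  | _ k ih =>
    intro j
    cases k with
    | zero => rw [MM_zero]; simp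
    | succ k =>
      have h := MM_rec2 j k
      have i1 := ih k (Nat.lt_succ_self k)
      have i2 : (if k = 0 then 0 else MM j (k-1)) = if j + 1 = k then (k:ℝ) else 0 := by
        cases k with
        | zero => simp
        | succ k =>
          simp only [Nat.succ_ne_zero, if_false, Nat.add_sub_cancel]
          rw [ih k (by omega) j]
          simp
      have i3 : (if j = 0 then 0 else MM (j-1) k) = if j = k + 1 then (k:ℝ)+1 else 0 := by
        cases j with
        | zero => simp
        | succ j =>
          simp only [Nat.succ_ne_zero, if_false, Nat.add_sub_cancel]
          rw [i1 j]; simp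
      rw [i2, i3, i1 (j+1), i1 j] at h
      have hk : ((k:ℝ)+1) ≠ 0 := by positivity
      apply mul_left_cancel₀ hk
      rcases lt_trichotomy j k with h1 | h1 | h1
      · by_cases h2 : j + 1 = k
        · have h3 : j ≠ k := by omega
          have h4 : j ≠ k + 1 := by omega
          simp only [h2, h3, h4, if_true, if_false] at h ⊢
          have : (k:ℝ) = j + 1 := by rw [← h2]; push_cast; ring
          rw [this] at h ⊢
          push_cast
          linarith
        · have h3 : j ≠ k := by omega
          have h4 : j ≠ k + 1 := by omega
          simp only [h2, h3, h4, if_false] at h ⊢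
          linarith
      · subst h1
        simp at h
        rw [if_neg (by omega)]
        linarith
      · by_cases h2 : j = k + 1
        · have h3 : j ≠ k := by omega
          have h4 : j + 1 ≠ k := by omega
          simp only [h2, if_true] at h ⊢
          simp at h
          rw [if_neg (by omega), if_neg (by omega)] at h
          push_cast
          linarith
        · have h3 : j ≠ k := by omega
          have h4 : j + 1 ≠ k := by omega
          simp only [h2, h3, h4, if_false] at h ⊢
          linarith

theorem norm_sum (c : ℕ → ℝ) (n : ℕ) :
    Lf 1 (X * (∑ k ∈ Finset.range n, C (c k) * pB k)^2) = ∑ k ∈ Finset.range n, (c k)^2 * ((k:ℝ)+1) := by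
  induction n with
  | zero => simp [Lf_zero]
  | succ n ih =>
    rw [Finset.sum_range_succ, Finset.sum_range_succ]
    set S := ∑ k ∈ Finset.range n, C (c k) * pB k with hS
    have h0 : Lf 1 (X * (S * pB n)) = 0 := by
      have : X * (S * pB n) = ∑ k ∈ Finset.range n, C (c k) * (X * (pB k * pB n)) := by
        rw [hS, Finset.sum_mul, Finset.mul_sum]
        apply Finset.sum_congr rfl; intro k _; ring
      rw [this, Lf_sum 1 one_pos]
      apply Finset.sum_eq_zero
      intro k hk
      have hk' : k ≠ n := (Finset.mem_range.1 hk).ne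
      have := MM_eq n k
      rw [MM, if_neg hk'] at this
      rw [Lf_C_mul, this, mul_zero]
    have e : X * (S + C (c n) * pB n)^2 = X * S^2 + (C (2 * c n) * (X * (S * pB n)) +
        C ((c n)^2) * (X * (pB n * pB n))) := by
      simp only [C_mul, C_pow, C_ofNat]; ring
    have h1 := MM_eq n n
    rw [MM, if_pos rfl] at h1
    rw [e, Lf_add 1 one_pos, Lf_add 1 one_pos, Lf_C_mul, Lf_C_mul, h0, h1, ih]
    ring

theorem pS_norm (n : ℕ) : Lf 1 (X * (pS n)^2) = n * (n+1) / 2 := by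
  rw [pS, norm_sum]
  induction n with
  | zero => simp
  | succ n ih =>
    rw [Finset.sum_range_succ, ih, ← pow_mul, mul_comm n 2, pow_mul]
    push_cast; norm_num; ring

theorem X_mul_pS (n : ℕ) : X * pS (n+1) = (∑ k ∈ Finset.range n, C (4 * ((k:ℝ)+1) * (-1)^k) * pB k)
    + C ((3*(n:ℝ)+2) * (-1)^n) * pB n + C (((n:ℝ)+1) * (-1)^(n+1)) * pB (n+1) := by
  induction n with
  | zero =>
    have := pB_three_zero
    simp only [pS, C_neg, C_1] at this ⊢
    simp
    rw [C_ofNat]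
    linear_combination this
  | succ n ih =>
    have e : pS (n+1+1) = pS (n+1) + C ((-1:ℝ)^(n+1)) * pB (n+1) := by
      rw [pS, Finset.sum_range_succ, ← pS]
    rw [e, mul_add, ih, Finset.sum_range_succ]
    have := pB_three n
    simp only [C_mul, C_add, C_neg, C_pow, C_ofNat, C_1, Nat.cast_add, Nat.cast_one, pow_succ] at this ⊢
    linear_combination (-(-1)^n) * this

theorem pS_weighted (n : ℕ) : Lf 1 (X^3 * (pS n)^2) ≤ 16 * ((n:ℝ)+1)^4 := by
  cases n with
  | zero => simp [pS, Lf_zero]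
  | succ n =>
    let c : ℕ → ℝ := fun k => if k < n then 4 * ((k:ℝ)+1) * (-1)^k else
      if k = n then (3*(n:ℝ)+2) * (-1)^n else ((n:ℝ)+1) * (-1)^(n+1)
    have hc : X * pS (n+1) = ∑ k ∈ Finset.range (n+2), C (c k) * pB k := by
      rw [X_mul_pS, Finset.sum_range_succ, Finset.sum_range_succ]
      have h1 : ∀ k ∈ Finset.range n, C (4 * ((k:ℝ)+1) * (-1)^k) * pB k = C (c k) * pB k := by
        intro k hk
        simp only [c, if_pos (Finset.mem_range.1 hk)]
      rw [Finset.sum_congr rfl h1]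
      simp [c]
    have e : X^3 * (pS (n+1))^2 = X * (∑ k ∈ Finset.range (n+2), C (c k) * pB k)^2 := by
      rw [← hc]; ring
    rw [e, norm_sum]
    have hb : ∀ k ∈ Finset.range (n+2), (c k)^2 * ((k:ℝ)+1) ≤ 16 * ((n:ℝ)+2)^3 := by
      intro k hk
      have hk2 : (k:ℝ) + 1 ≤ n + 2 := by
        have := Finset.mem_range.1 hk
        exact_mod_cast this
      have h2 : (c k)^2 ≤ 16 * ((n:ℝ)+2)^2 := by
        have hn : (0:ℝ) ≤ n := Nat.cast_nonneg n
        have hk0 : (0:ℝ) ≤ k := Nat.cast_nonneg k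
        have hs : ∀ m : ℕ, ((-1:ℝ)^m)^2 = 1 := by
          intro m; rw [← pow_mul, mul_comm, pow_mul]; norm_num
        simp only [c]
        split_ifs
        · rw [mul_pow, hs]; nlinarith
        · rw [mul_pow, hs]; nlinarith
        · rw [mul_pow, hs]; nlinarith
      calc _ ≤ 16 * ((n:ℝ)+2)^2 * ((n:ℝ)+2) := by gcongr
        _ = _ := by ring
    refine (Finset.sum_le_sum hb).trans ?_
    simp
    nlinarith [pow_nonneg (show (0:ℝ) ≤ (n:ℝ)+2 by positivity) 3]

theorem Lf_pS (s : ℝ) (hs : 0 < s) (n : ℕ) :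
    Lf s (X * pS n) * (s^2 * (2 - 1/s)^2) =
      1 - (n+1) * (1/s - 1)^n + n * (1/s-1)^(n+1) := by
  induction n with
  | zero => simp [pS, Lf_zero]
  | succ n ih =>
    have e : X * pS (n+1) = X * pS n + C ((-1:ℝ)^n) * (X * pB n) := by
      rw [pS, Finset.sum_range_succ, ← pS]; ring
    rw [e, Lf_add s hs, Lf_C_mul, Lf_XpB s hs, add_mul, ih]
    have : (1/s - 1)^n = (-1)^n * (1 - 1/s)^n := by rw [← mul_pow]; ring
    have h2 : (-1:ℝ)^n * (((n:ℝ)+1) * (1-1/s)^n/s^2) * (s^2 * (2-1/s)^2) = ((n:ℝ)+1) * (2-1/s)^2 * (1/s-1)^n := by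
      rw [this]; field_simp
    rw [h2]
    push_cast
    ring

end PartD

section PartE
open Polynomial

noncomputable def fN (N : ℕ) (v : ℝ) : ℝ := 4 * Real.exp (-(N * v)/2) * (pS (N-1)).eval (N * v)

noncomputable def chi (v : ℝ) : ℝ := if v < 4 then 1 else 0

theorem scal_int (N : ℕ) (hN : 1 ≤ N) (s : ℝ) (hs : 0 < s) (q : ℝ[X]) :
    IntegrableOn (fun v : ℝ => q.eval (N * v) * Real.exp (-(s * (N * v)))) (Set.Ioi 0) := by
  have hN' : (0:ℝ) < N := by exact_mod_cast hN
  have := (integrableOn_Ioi_comp_mul_left_iff (fun t : ℝ => q.eval t * Real.exp (-(s*t))) 0 hN').2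
    (by rw [mul_zero]; exact Lf_int s hs q)
  exact this

theorem scal_integral (N : ℕ) (hN : 1 ≤ N) (s : ℝ) (q : ℝ[X]) :
    ∫ v in Set.Ioi (0:ℝ), q.eval (N * v) * Real.exp (-(s * (N * v))) = (N:ℝ)⁻¹ * Lf s q := by
  have hN' : (0:ℝ) < N := by exact_mod_cast hN
  have := integral_comp_mul_left_Ioi (fun t : ℝ => q.eval t * Real.exp (-(s*t))) 0 hN'
  rw [mul_zero] at this
  simpa [Lf] using this

theorem fN_sq (N : ℕ) (v : ℝ) : fN N v ^ 2 = 16 * ((pS (N-1))^2).eval (N*v) * Real.exp (-(1 * (N * v))) := by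
  have : Real.exp (-(1 * (N * v))) = Real.exp (-(N * v)/2) ^ 2 := by
    rw [← Real.exp_nat_mul]; congr 1; push_cast; ring
  rw [fN, this, eval_pow]; ring

theorem fN_form1 (N : ℕ) (hN : 1 ≤ N) : (fun v : ℝ => v * fN N v ^ 2) = fun v =>
    16 * (N:ℝ)⁻¹ * ((X * (pS (N-1))^2).eval (N*v) * Real.exp (-(1 * (N * v)))) := by
  have hN' : (0:ℝ) < N := by exact_mod_cast hN
  ext v
  rw [fN_sq, eval_mul, eval_X]; field_simp

theorem fN_form3 (N : ℕ) (hN : 1 ≤ N) : (fun v : ℝ => v^3 * fN N v ^ 2) = fun v =>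
    16 * ((N:ℝ)⁻¹)^3 * ((X^3 * (pS (N-1))^2).eval (N*v) * Real.exp (-(1 * (N * v)))) := by
  have hN' : (0:ℝ) < N := by exact_mod_cast hN
  ext v
  rw [fN_sq, eval_mul, eval_pow, eval_pow, eval_X]; field_simp

theorem fN_formE (N : ℕ) (hN : 1 ≤ N) (l : ℝ) : (fun v : ℝ => v * (fN N v * Real.exp (-(l * v)))) = fun v =>
    4 * (N:ℝ)⁻¹ * ((X * (pS (N-1))).eval (N*v) * Real.exp (-((1/2 + l/N) * (N * v)))) := by
  have hN' : (0:ℝ) < N := by exact_mod_cast hN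
  ext v
  have : Real.exp (-((1/2 + l/N) * (N * v))) = Real.exp (-(N * v)/2) * Real.exp (-(l*v)) := by
    rw [← Real.exp_add]; congr 1; field_simp; ring
  rw [this, fN, eval_mul, eval_X]; field_simp

theorem fN_int1 (N : ℕ) (hN : 1 ≤ N) : IntegrableOn (fun v : ℝ => v * fN N v ^ 2) (Set.Ioi 0) := by
  rw [fN_form1 N hN]; exact (scal_int N hN 1 one_pos _).const_mul _

theorem fN_int3 (N : ℕ) (hN : 1 ≤ N) : IntegrableOn (fun v : ℝ => v^3 * fN N v ^ 2) (Set.Ioi 0) := by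
  rw [fN_form3 N hN]; exact (scal_int N hN 1 one_pos _).const_mul _

theorem fN_norm (N : ℕ) (hN : 1 ≤ N) : ∫ v in Set.Ioi (0:ℝ), v * fN N v ^ 2 = 8 - 8 / N := by
  have hN' : (0:ℝ) < N := by exact_mod_cast hN
  rw [fN_form1 N hN, integral_const_mul, scal_integral N hN, pS_norm]
  rw [Nat.cast_sub hN]; push_cast; field_simp; ring

theorem fN_norm3 (N : ℕ) (hN : 1 ≤ N) : ∫ v in Set.Ioi (0:ℝ), v^3 * fN N v ^ 2 ≤ 256 := by
  have hN' : (0:ℝ) < N := by exact_mod_cast hN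
  rw [fN_form3 N hN, integral_const_mul, scal_integral N hN]
  have h := pS_weighted (N-1)
  rw [Nat.cast_sub hN] at h
  push_cast at h
  rw [sub_add_cancel] at h
  calc _ = 16 * ((N:ℝ)⁻¹)^4 * Lf 1 (X^3 * (pS (N-1))^2) := by ring
    _ ≤ 16 * ((N:ℝ)⁻¹)^4 * (16 * (N:ℝ)^4) := by gcongr
    _ = 256 := by field_simp; norm_num

theorem fN_lap (l : ℝ) (hl : 0 < l) : Tendsto (fun N : ℕ => ∫ v in Set.Ioi (0:ℝ), v * (fN N v * Real.exp (-(l * v))))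
    atTop (nhds ((1 - Real.exp (-(4*l)) * (1 + 4 * l)) / l^2)) := by
  let s : ℕ → ℝ := fun N => 1/2 + l/N
  let q : ℕ → ℝ := fun N => 1/s N - 1
  have hs0 : ∀ N, 0 < s N := fun N => by simp only [s]; positivity
  have hs : Tendsto s atTop (nhds (1/2)) := by
    have := (tendsto_const_div_atTop_nhds_zero_nat l).const_add (1/2)
    simpa [s] using this
  have hq : Tendsto q atTop (nhds 1) := by
    have := (hs.inv₀ (by norm_num)).sub_const 1
    norm_num at this
    simpa [q] using this
  have hN1 : Tendsto (fun N : ℕ => (N:ℝ) * (1 - q N)) atTop (nhds (4*l)) := by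
    have h1 : Tendsto (fun N => 2 * l * (s N)⁻¹) atTop (nhds (2 * l * (1/2)⁻¹)) :=
      (hs.inv₀ (by norm_num)).const_mul (2*l)
    have : 2 * l * (1/2:ℝ)⁻¹ = 4 * l := by norm_num; ring
    rw [this] at h1
    refine h1.congr' ?_
    filter_upwards [eventually_ge_atTop 1] with N hN
    have hN' : (0:ℝ) < N := by exact_mod_cast hN
    have h3 := (hs0 N).ne'
    have h4 : (N:ℝ) * (2 * s N - 1) = 2 * l := by simp only [s]; field_simp; ring
    simp only [q]; field_simp; linarith
  have hqN : Tendsto (fun N : ℕ => q N ^ N) atTop (nhds (Real.exp (-(4*l)))) := by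
    have := Real.tendsto_one_add_pow_exp_of_tendsto (g := fun N => q N - 1) (t := -(4*l))
      (hN1.neg.congr fun N => by ring)
    refine this.congr fun N => by ring
  have hlim : Tendsto (fun N : ℕ => (1 - q N ^ N * (1 + N * (1 - q N) / q N)) / l^2) atTop
      (nhds ((1 - Real.exp (-(4*l)) * (1 + 4 * l / 1)) / l^2)) :=
    ((hqN.mul ((hN1.div hq one_ne_zero).const_add 1)).const_sub 1).div_const _
  rw [div_one] at hlim
  refine hlim.congr' ?_
  filter_upwards [eventually_ge_atTop 1, hq.eventually (eventually_gt_nhds (show (0:ℝ) < 1 by norm_num))]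
    with N hN hqp
  have hN' : (0:ℝ) < N := by exact_mod_cast hN
  have h := Lf_pS (s N) (hs0 N) (N-1)
  rw [fN_formE N hN, integral_const_mul, scal_integral N hN]
  change _ = 4 * (N:ℝ)⁻¹ * ((N:ℝ)⁻¹ * Lf (s N) (X * pS (N-1)))
  change _ = 1 - _ * (q N)^(N-1) + _ * (q N)^(N-1+1) at h
  rw [Nat.cast_sub hN, Nat.sub_add_cancel hN] at h
  have hp : q N ^ N = q N ^ (N-1) * q N := by rw [← pow_succ, Nat.sub_add_cancel hN]
  have h5 : (s N)^2 * (2 - 1/s N)^2 = 4 * l^2 / N^2 := by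
    have := (hs0 N).ne'
    have e : (s N) * (2 - 1/s N) = 2 * l / N := by
      have : (s N) * (2 - 1/s N) = 2 * s N - 1 := by field_simp
      rw [this]; simp only [s]; ring
    rw [← mul_pow, e]; ring
  rw [h5, hp] at h
  rw [hp]
  push_cast at h
  have h6 : 4 * (N:ℝ)⁻¹ * ((N:ℝ)⁻¹ * Lf (s N) (X * pS (N-1))) =
    (Lf (s N) (X * pS (N-1)) * (4 * l^2/N^2)) / l^2 := by field_simp
  rw [h6, h]
  field_simp
  ring

theorem chi_meas : Measurable chi := by
  unfold chi
  exact Measurable.ite measurableSet_Iio measurable_const measurable_const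

theorem chi_integral (F : ℝ → ℝ) : ∫ v in Set.Ioi (0:ℝ), (F v * chi v) = ∫ v in (0:ℝ)..4, F v := by
  rw [intervalIntegral.integral_of_le (by norm_num), integral_Ioc_eq_integral_Ioo,
    ← Set.Ioi_inter_Iio, Set.inter_comm, ← Measure.restrict_restrict measurableSet_Iio, ← integral_indicator measurableSet_Iio]
  congr 1; ext v
  by_cases h : v < 4 <;> simp [chi, h]

theorem chi_integrable (F : ℝ → ℝ) (hF : Continuous F) : IntegrableOn (fun v => F v * chi v) (Set.Ioi 0) := by
  have h : IntegrableOn F (Set.Iio 4 ∩ Set.Ioi 0) :=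
    (hF.continuousOn.integrableOn_Icc (a := 0) (b := 4)).mono_set
      (fun x hx => ⟨le_of_lt hx.2, le_of_lt hx.1⟩)
  rw [IntegrableOn, ← Measure.restrict_restrict measurableSet_Iio] at h
  have := (integrable_indicator_iff measurableSet_Iio).2 h
  refine this.congr (ae_of_all _ fun v => ?_)
  by_cases h : v < 4 <;> simp [chi, h]

theorem chi_lap (l : ℝ) (hl : 0 < l) : ∫ v in Set.Ioi (0:ℝ), v * (chi v * Real.exp (-(l * v))) =
    (1 - Real.exp (-(4*l)) * (1 + 4 * l)) / l^2 := by
  have : (fun v : ℝ => v * (chi v * Real.exp (-(l * v)))) = fun v => (v * Real.exp (-(l*v))) * chi v := by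
    ext v; ring
  rw [this, chi_integral]
  rw [intervalIntegral.integral_eq_sub_of_hasDerivAt (f := fun v => -(v/l + 1/l^2) * Real.exp (-(l*v)))]
  · simp only [mul_zero, neg_zero, Real.exp_zero, mul_comm l 4]; field_simp; ring
  · intro v _
    have h1 : HasDerivAt (fun v : ℝ => Real.exp (-(l*v))) (Real.exp (-(l*v)) * (-(l*1))) v :=
      (((hasDerivAt_id v).const_mul l).neg).exp
    have h2 : HasDerivAt (fun v : ℝ => -(v/l + 1/l^2)) (-(1/l)) v :=
      (((hasDerivAt_id v).div_const l).add_const _).neg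
    refine (h2.mul h1).congr_deriv ?_
    field_simp; ring
  · apply Continuous.intervalIntegrable; fun_prop

/-- weighted square integrability -/
def L2w (f : ℝ → ℝ) : Prop := Measurable f ∧ IntegrableOn (fun v : ℝ => v * f v ^ 2) (Set.Ioi 0)

theorem L2w.mul {f g : ℝ → ℝ} (hf : L2w f) (hg : L2w g) :
    IntegrableOn (fun v : ℝ => v * (f v * g v)) (Set.Ioi 0) := by
  refine Integrable.mono' (hf.2.add hg.2) ?_ ?_
  · exact (measurable_id.mul (hf.1.mul hg.1)).aestronglyMeasurable
  · refine (ae_restrict_iff' measurableSet_Ioi).2 (ae_of_all _ fun v hv => ?_)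
    have hv' : (0:ℝ) < v := hv
    rw [Real.norm_eq_abs, abs_mul, abs_of_pos hv', Pi.add_apply, ← mul_add]
    apply mul_le_mul_of_nonneg_left _ hv'.le
    rw [abs_le]; constructor <;> nlinarith [sq_nonneg (f v + g v), sq_nonneg (f v - g v), sq_nonneg (f v), sq_nonneg (g v)]

theorem L2w.sub_integral {f g : ℝ → ℝ} (hf : L2w f) (hg : L2w g) :
    IntegrableOn (fun v : ℝ => v * (f v - g v)^2) (Set.Ioi 0) ∧
    ∫ v in Set.Ioi (0:ℝ), v * (f v - g v)^2 = (∫ v in Set.Ioi (0:ℝ), v * f v^2)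
      - 2 * (∫ v in Set.Ioi (0:ℝ), v * (f v * g v)) + ∫ v in Set.Ioi (0:ℝ), v * g v^2 := by
  have e : (fun v : ℝ => v * (f v - g v)^2) = fun v => (v * f v^2 - 2 * (v * (f v * g v))) + v * g v^2 := by
    ext v; ring
  have hm := hf.mul hg
  have h1 : Integrable (fun v => v * f v^2 - 2 * (v * (f v * g v))) (volume.restrict (Set.Ioi 0)) :=
    Integrable.sub hf.2 (hm.const_mul 2)
  rw [e]
  refine ⟨Integrable.add h1 hg.2, ?_⟩
  rw [integral_add h1 hg.2, integral_sub hf.2 (hm.const_mul 2), integral_const_mul]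

theorem L2w.sub {f g : ℝ → ℝ} (hf : L2w f) (hg : L2w g) : L2w (fun v => f v - g v) :=
  ⟨hf.1.sub hg.1, (hf.sub_integral hg).1⟩

theorem L2w_fN (N : ℕ) (hN : 1 ≤ N) : L2w (fN N) := by
  refine ⟨?_, fN_int1 N hN⟩
  apply Continuous.measurable
  unfold fN
  fun_prop

theorem chi_sq (v : ℝ) : chi v ^ 2 = chi v := by unfold chi; split_ifs <;> norm_num

theorem L2w_chi : L2w chi := by
  refine ⟨chi_meas, ?_⟩
  simp only [chi_sq]
  exact chi_integrable _ continuous_id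

theorem chi_norm : ∫ v in Set.Ioi (0:ℝ), v * chi v ^ 2 = 8 := by
  simp only [chi_sq]
  rw [chi_integral (fun v => v)]; simp; norm_num

noncomputable def gq (q : ℝ[X]) (v : ℝ) : ℝ := Real.exp (-v) * q.eval (Real.exp (-v))

theorem gq_add (p q : ℝ[X]) : gq (p + q) = fun v => gq p v + gq q v := by
  ext v; simp [gq]; ring

theorem gq_monomial (n : ℕ) (a : ℝ) : gq (monomial n a) = fun v => a * Real.exp (-(((n:ℝ)+1) * v)) := by
  ext v
  have : Real.exp (-(((n:ℝ)+1) * v)) = Real.exp (-v) * Real.exp (-v)^n := by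
    rw [← Real.exp_nat_mul, ← Real.exp_add]; congr 1; ring
  rw [gq, eval_monomial, this]; ring

theorem gq_cont (q : ℝ[X]) : Continuous (gq q) := by unfold gq; fun_prop

theorem L2w_gq (q : ℝ[X]) : L2w (gq q) := by
  refine ⟨(gq_cont q).measurable, ?_⟩
  obtain ⟨M, hM⟩ := (isCompact_Icc (a := (0:ℝ)) (b := 1)).exists_bound_of_continuousOn
    (f := fun x => q.eval x) (by fun_prop)
  have h := (Lf_int 2 (by norm_num) X).const_mul (M^2)
  refine Integrable.mono' h ?_ ?_
  · exact (continuous_id.mul ((gq_cont q).pow 2)).aestronglyMeasurable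
  · refine (ae_restrict_iff' measurableSet_Ioi).2 (ae_of_all _ fun v hv => ?_)
    have hv' : (0:ℝ) < v := hv
    have h1 := hM (Real.exp (-v)) ⟨(Real.exp_pos _).le, by rw [Real.exp_le_one_iff]; linarith⟩
    have h2 : Real.exp (-(2*v)) = Real.exp (-v)^2 := by
      rw [← Real.exp_nat_mul]; congr 1; push_cast; ring
    have h3 : (q.eval (Real.exp (-v)))^2 ≤ M^2 := by
      rw [← sq_abs]
      exact pow_le_pow_left₀ (abs_nonneg _) h1 2
    rw [Real.norm_of_nonneg (by positivity), eval_X, h2, gq]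
    calc _ = (q.eval (Real.exp (-v)))^2 * (v * Real.exp (-v)^2) := by ring
      _ ≤ _ := by gcongr

theorem weak_gq (q : ℝ[X]) : Tendsto (fun N : ℕ => ∫ v in Set.Ioi (0:ℝ), v * (fN N v * gq q v)) atTop
    (nhds (∫ v in Set.Ioi (0:ℝ), v * (chi v * gq q v))) := by
  induction q using Polynomial.induction_on' with
  | add p q hp hq =>
    have e : ∀ f, L2w f → ∫ v in Set.Ioi (0:ℝ), v * (f v * gq (p+q) v) =
        (∫ v in Set.Ioi (0:ℝ), v * (f v * gq p v)) + ∫ v in Set.Ioi (0:ℝ), v * (f v * gq q v) := by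
      intro f hf
      rw [← integral_add (hf.mul (L2w_gq p)) (hf.mul (L2w_gq q)), gq_add]
      congr 1; ext v; ring
    rw [e _ L2w_chi]
    refine (hp.add hq).congr' ?_
    filter_upwards [eventually_ge_atTop 1] with N hN
    rw [e _ (L2w_fN N hN)]
  | monomial n a =>
    rw [gq_monomial]
    have e : ∀ f : ℝ → ℝ, ∫ v in Set.Ioi (0:ℝ), v * (f v * (a * Real.exp (-(((n:ℝ)+1) * v)))) =
      a * ∫ v in Set.Ioi (0:ℝ), v * (f v * Real.exp (-(((n:ℝ)+1) * v))) := by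
      intro f; rw [← integral_const_mul]; congr 1; ext v; ring
    simp only [e]
    rw [chi_lap _ (by positivity)]
    exact (fN_lap _ (by positivity)).const_mul a

theorem lim_gq (q : ℝ[X]) : Tendsto (fun N : ℕ => ∫ v in Set.Ioi (0:ℝ), v * (fN N v - gq q v)^2) atTop
    (nhds (∫ v in Set.Ioi (0:ℝ), v * (chi v - gq q v)^2)) := by
  rw [(L2w_chi.sub_integral (L2w_gq q)).2, chi_norm]
  have h8 : Tendsto (fun N : ℕ => (8:ℝ) - 8 / N) atTop (nhds 8) := by
    simpa using (tendsto_const_div_atTop_nhds_zero_nat (8:ℝ)).const_sub 8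
  refine ((h8.sub ((weak_gq q).const_mul 2)).add_const _).congr' ?_
  filter_upwards [eventually_ge_atTop 1] with N hN
  rw [((L2w_fN N hN).sub_integral (L2w_gq q)).2, fN_norm N hN]

end PartE

section PartF
open Polynomial

theorem approx_chi (ε : ℝ) (hε : 0 < ε) : ∃ q : ℝ[X], ∫ v in Set.Ioi (0:ℝ), v * (chi v - gq q v)^2 ≤ ε := by
  set δ := ε/16 with hδ
  have hδ0 : 0 < δ := by positivity
  set η := Real.sqrt (ε/4) with hη
  have hη0 : 0 < η := Real.sqrt_pos.2 (by positivity)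
  have hη2 : η^2 = ε/4 := Real.sq_sqrt (by positivity)
  let f : ℝ → ℝ := fun v => max 0 (min 1 ((4-v)/δ))
  let m : ℝ → ℝ := fun w => max w (Real.exp (-4))
  have hm0 : ∀ w, 0 < m w := fun w => lt_max_of_lt_right (Real.exp_pos _)
  have hmc : Continuous m := by fun_prop
  let h : ℝ → ℝ := fun w => f (-Real.log (m w)) / m w
  have hfc : Continuous f := by
    simp only [f]; fun_prop
  have hhc : Continuous h :=
    (hfc.comp ((hmc.log fun w => (hm0 w).ne').neg)).div hmc fun w => (hm0 w).ne'
  have hf4 : ∀ v, 4 ≤ v → f v = 0 := by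
    intro v hv
    simp only [f]
    apply max_eq_left
    exact (min_le_right _ _).trans (div_nonpos_of_nonpos_of_nonneg (by linarith) hδ0.le)
  have hfh : ∀ v, f v = Real.exp (-v) * h (Real.exp (-v)) := by
    intro v
    rcases le_total v 4 with hv | hv
    · have : m (Real.exp (-v)) = Real.exp (-v) := max_eq_left (Real.exp_le_exp.2 (by linarith))
      simp only [h, this, Real.log_exp, neg_neg]
      have := (Real.exp_pos (-v)).ne'
      field_simp
    · have : m (Real.exp (-v)) = Real.exp (-4) := max_eq_right (Real.exp_le_exp.2 (by linarith))
      simp only [h, this, Real.log_exp, neg_neg]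
      rw [hf4 v hv, hf4 4 le_rfl]; simp
  obtain ⟨q, hq⟩ := exists_polynomial_near_of_continuousOn 0 1 h hhc.continuousOn η hη0
  refine ⟨q, ?_⟩
  have hpt : ∀ v ∈ Set.Ioi (0:ℝ), v * (chi v - gq q v)^2 ≤
      8 * (Set.Icc (4-δ) 4).indicator (fun _ => (1:ℝ)) v + (ε/2) * Real.exp (-(1*v)) := by
    intro v hv
    have hv' : (0:ℝ) < v := hv
    have h1 : v * (chi v - f v)^2 ≤ 4 * (Set.Icc (4-δ) 4).indicator (fun _ => (1:ℝ)) v := by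
      by_cases h4 : v < 4
      · by_cases h5 : 4 - δ ≤ v
        · rw [Set.indicator_of_mem (show v ∈ Set.Icc (4-δ) 4 from ⟨h5, h4.le⟩)]
          have a1 : 0 ≤ f v := le_max_left _ _
          have a2 : f v ≤ 1 := max_le zero_le_one (min_le_left _ _)
          have a3 : chi v = 1 := by simp [chi, h4]
          rw [a3]
          have : (1 - f v)^2 ≤ 1 := by nlinarith
          nlinarith
        · have a1 : f v = 1 := by
            have : 1 ≤ (4-v)/δ := by rw [le_div_iff₀ hδ0]; linarith
            simp [f, min_eq_left this]
          have a3 : chi v = 1 := by simp [chi, h4]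
          rw [a1, a3]
          have : (0:ℝ) ≤ (Set.Icc (4-δ) 4).indicator (fun _ => (1:ℝ)) v :=
            Set.indicator_nonneg (fun _ _ => zero_le_one) v
          simpa using this
      · have a1 := hf4 v (not_lt.1 h4)
        have a3 : chi v = 0 := by simp [chi, h4]
        rw [a1, a3]
        have : (0:ℝ) ≤ (Set.Icc (4-δ) 4).indicator (fun _ => (1:ℝ)) v :=
          Set.indicator_nonneg (fun _ _ => zero_le_one) v
        simpa using this
    have h2 : v * (f v - gq q v)^2 ≤ (ε/4) * Real.exp (-(1*v)) := by
      have b1 := hq (Real.exp (-v)) ⟨(Real.exp_pos _).le, by rw [Real.exp_le_one_iff]; linarith⟩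
      have b2 : (q.eval (Real.exp (-v)) - h (Real.exp (-v)))^2 ≤ ε/4 := by
        rw [← hη2, ← sq_abs]
        exact pow_le_pow_left₀ (abs_nonneg _) b1.le 2
      have b3 : v * Real.exp (-v) ≤ 1 := by
        have := Real.add_one_le_exp v
        rw [Real.exp_neg]
        have := Real.exp_pos v
        rw [← div_eq_mul_inv, div_le_one this]; linarith
      rw [hfh v, gq, one_mul]
      calc _ = (q.eval (Real.exp (-v)) - h (Real.exp (-v)))^2 * (v * Real.exp (-v)) * Real.exp (-v) := by ring
        _ ≤ (ε/4) * 1 * Real.exp (-v) := by gcongr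
        _ = _ := by ring
    nlinarith [mul_nonneg hv'.le (sq_nonneg ((chi v - f v) - (f v - gq q v)))]
  have hi1 : IntegrableOn (fun v : ℝ => 8 * (Set.Icc (4-δ) 4).indicator (fun _ => (1:ℝ)) v) (Set.Ioi 0) := by
    apply Integrable.const_mul
    apply Integrable.integrableOn
    rw [integrable_indicator_iff measurableSet_Icc]
    exact continuous_const.continuousOn.integrableOn_Icc
  have hi2 : IntegrableOn (fun v : ℝ => (ε/2) * Real.exp (-(1*v))) (Set.Ioi 0) := by
    have := (Lf_int 1 one_pos 1).const_mul (ε/2)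
    exact IntegrableOn.congr_fun this (fun v _ => by simp) measurableSet_Ioi
  refine (setIntegral_mono_on (L2w_chi.sub_integral (L2w_gq q)).1 (hi1.add hi2) measurableSet_Ioi hpt).trans ?_
  have e := integral_add hi1 hi2
  have i2 : ∫ v in Set.Ioi (0:ℝ), (ε/2) * Real.exp (-(1*v)) = ε/2 := by
    rw [integral_const_mul]
    have := Lf_pow 1 one_pos 0
    simp only [Lf, pow_zero, eval_one, one_mul] at this ⊢
    rw [this]; simp
  have i1 : ∫ v in Set.Ioi (0:ℝ), 8 * (Set.Icc (4-δ) 4).indicator (fun _ => (1:ℝ)) v ≤ ε/2 := by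
    rw [integral_const_mul]
    have h0 : ∫ v in Set.Ioi (0:ℝ), (Set.Icc (4-δ) 4).indicator (fun _ => (1:ℝ)) v ≤
        ∫ v, (Set.Icc (4-δ) 4).indicator (fun _ => (1:ℝ)) v := by
      apply setIntegral_le_integral
      · rw [integrable_indicator_iff measurableSet_Icc]
        exact continuous_const.continuousOn.integrableOn_Icc
      · exact ae_of_all _ fun v => Set.indicator_nonneg (fun _ _ => zero_le_one) v
    have h01 : ∫ v, (Set.Icc (4-δ) 4).indicator (fun _ => (1:ℝ)) v = δ := by
      rw [integral_indicator measurableSet_Icc]; simp [hδ0.le]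
    rw [h01] at h0
    linarith
  calc _ = _ := e
    _ ≤ _ := by rw [i2]; linarith

theorem J_lim : Tendsto (fun N : ℕ => ∫ v in Set.Ioi (0:ℝ), v * (fN N v - chi v)^2) atTop (nhds 0) := by
  rw [Metric.tendsto_nhds]
  intro ε hε
  obtain ⟨q, hq⟩ := approx_chi (ε/8) (by positivity)
  have h1 := (lim_gq q).eventually (eventually_lt_nhds (show _ < ε/4 by linarith))
  filter_upwards [h1, eventually_ge_atTop 1] with N hN hN1
  have h0 : 0 ≤ ∫ v in Set.Ioi (0:ℝ), v * (fN N v - chi v)^2 :=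
    setIntegral_nonneg measurableSet_Ioi fun v hv => mul_nonneg (le_of_lt hv) (sq_nonneg _)
  rw [Real.dist_eq, sub_zero, abs_of_nonneg h0]
  have i1 := ((L2w_fN N hN1).sub_integral (L2w_gq q)).1
  have i2 := (L2w_chi.sub_integral (L2w_gq q)).1
  have h2 := setIntegral_mono_on (((L2w_fN N hN1).sub_integral L2w_chi).1)
    ((i1.const_mul 2).add (i2.const_mul 2)) measurableSet_Ioi (fun v hv => by
      have hv' : (0:ℝ) < v := hv
      simp only [Pi.add_apply]
      nlinarith [mul_nonneg hv'.le (sq_nonneg ((fN N v - gq q v) + (chi v - gq q v)))])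
  have h3 := integral_add (i1.const_mul 2) (i2.const_mul 2)
  rw [integral_const_mul, integral_const_mul] at h3
  have h4 := h2.trans h3.le
  linarith

theorem D_int3 (N : ℕ) (hN : 1 ≤ N) : IntegrableOn (fun v : ℝ => v^3 * (fN N v - chi v)^2) (Set.Ioi 0) ∧
    ∫ v in Set.Ioi (0:ℝ), v^3 * (fN N v - chi v)^2 ≤ 1000 := by
  have i1 := (fN_int3 N hN).const_mul 2
  have i2 := (chi_integrable (fun v => v^3) (by fun_prop)).const_mul 2
  have hb : ∀ v ∈ Set.Ioi (0:ℝ), v^3 * (fN N v - chi v)^2 ≤ 2 * (v^3 * fN N v^2) + 2 * (v^3 * chi v) := by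
    intro v hv
    have hv' : (0:ℝ) < v^3 := pow_pos hv 3
    have := chi_sq v
    nlinarith [mul_nonneg hv'.le (sq_nonneg (fN N v + chi v))]
  have i0 : IntegrableOn (fun v : ℝ => v^3 * (fN N v - chi v)^2) (Set.Ioi 0) := by
    refine Integrable.mono' (i1.add i2) ?_ ?_
    · exact (((measurable_id.pow_const 3)).mul (((L2w_fN N hN).1.sub chi_meas).pow_const 2)).aestronglyMeasurable
    · refine (ae_restrict_iff' measurableSet_Ioi).2 (ae_of_all _ fun v hv => ?_)
      have hv' : (0:ℝ) < v := hv
      rw [Real.norm_of_nonneg (by positivity)]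
      exact hb v hv
  refine ⟨i0, ?_⟩
  have h2 := setIntegral_mono_on i0 (i1.add i2) measurableSet_Ioi hb
  have h3 := integral_add i1 i2
  rw [integral_const_mul, integral_const_mul, chi_integral (fun v => v^3)] at h3
  have h4 : ∫ v in (0:ℝ)..4, v^3 = 64 := by rw [integral_pow]; norm_num
  rw [h4] at h3
  have h5 := h2.trans h3.le
  have := fN_norm3 N hN
  linarith

theorem L1_bound (N : ℕ) (hN : 1 ≤ N) (ε : ℝ) (hε : 0 < ε) :
    IntegrableOn (fun v : ℝ => Real.sqrt v * |fN N v - chi v|) (Set.Ioi 0) ∧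
    ∫ v in Set.Ioi (0:ℝ), Real.sqrt v * |fN N v - chi v| ≤
      ε⁻¹^3 * (∫ v in Set.Ioi (0:ℝ), v * (fN N v - chi v)^2) + 1000 * ε + 4 * ε := by
  have i1 := (((L2w_fN N hN).sub_integral L2w_chi).1).const_mul (ε⁻¹^3)
  obtain ⟨i2', hi2⟩ := D_int3 N hN
  have i2 := i2'.const_mul ε
  have hε2 : 0 < ε^2 := by positivity
  have i3' : IntegrableOn (fun v : ℝ => (1 + (ε^2 * v)^2)⁻¹) (Set.Ioi 0) :=
    (integrable_inv_one_add_sq.comp_mul_left' hε2.ne').integrableOn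
  have i3 := i3'.const_mul (ε^3)
  have hi3 : ∫ v in Set.Ioi (0:ℝ), ε^3 * (1 + (ε^2 * v)^2)⁻¹ ≤ 4 * ε := by
    rw [integral_const_mul]
    have := integral_comp_mul_left_Ioi (fun x : ℝ => (1 + x^2)⁻¹) 0 hε2
    rw [this, mul_zero, integral_Ioi_inv_one_add_sq]
    simp only [Real.arctan_zero, sub_zero, smul_eq_mul]
    have hpi := Real.pi_le_four
    have : ε^3 * ((ε^2)⁻¹ * (Real.pi/2)) = ε * (Real.pi/2) := by field_simp
    rw [this]; nlinarith
  have hb : ∀ v ∈ Set.Ioi (0:ℝ), Real.sqrt v * |fN N v - chi v| ≤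
      ε⁻¹^3 * (v * (fN N v - chi v)^2) + ε * (v^3 * (fN N v - chi v)^2) + ε^3 * (1 + (ε^2 * v)^2)⁻¹ := by
    intro v hv
    have hv' : (0:ℝ) < v := hv
    set W := ε⁻¹^3 + ε * v^2 with hW
    have hW0 : 0 < W := by positivity
    have hWi : ε^3 * (1 + (ε^2 * v)^2)⁻¹ = W⁻¹ := by
      have : W = (1 + (ε^2*v)^2) / ε^3 := by rw [hW]; field_simp
      rw [this, inv_div]; ring
    rw [hWi]
    set a := Real.sqrt v * |fN N v - chi v| with ha
    have ha2 : a^2 = v * (fN N v - chi v)^2 := by rw [ha, mul_pow, Real.sq_sqrt hv'.le, sq_abs]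
    have : ε⁻¹^3 * (v * (fN N v - chi v)^2) + ε * (v^3 * (fN N v - chi v)^2) = W * a^2 := by
      rw [ha2, hW]; ring
    rw [this]
    have h0 : 0 ≤ a := by positivity
    have : W * a^2 + W⁻¹ - a = W⁻¹ * ((W*a - 1/2)^2 + 3/4) := by field_simp; ring
    have h1 : 0 ≤ W⁻¹ * ((W*a - 1/2)^2 + 3/4) := by positivity
    linarith
  have i0 : IntegrableOn (fun v : ℝ => Real.sqrt v * |fN N v - chi v|) (Set.Ioi 0) := by
    refine Integrable.mono' ((i1.add i2).add i3) ?_ ?_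
    · exact (Real.continuous_sqrt.measurable.mul
        (continuous_abs.measurable.comp ((L2w_fN N hN).1.sub chi_meas))).aestronglyMeasurable
    · refine (ae_restrict_iff' measurableSet_Ioi).2 (ae_of_all _ fun v hv => ?_)
      rw [Real.norm_of_nonneg (by positivity)]
      exact hb v hv
  refine ⟨i0, ?_⟩
  have h2 := setIntegral_mono_on i0 ((i1.add i2).add i3) measurableSet_Ioi hb
  have h3 := integral_add (i1.add i2) i3
  have h4 := integral_add i1 i2
  rw [integral_const_mul, integral_const_mul] at h4
  simp only [Pi.add_apply] at h2 h3 h4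
  have h5 : ε * ∫ v in Set.Ioi (0:ℝ), v^3 * (fN N v - chi v)^2 ≤ ε * 1000 := by gcongr
  calc _ ≤ _ := h2
    _ = _ := h3
    _ ≤ _ := by rw [h4]; linarith

theorem L1_lim : Tendsto (fun N : ℕ => ∫ v in Set.Ioi (0:ℝ), Real.sqrt v * |fN N v - chi v|) atTop (nhds 0) := by
  rw [Metric.tendsto_nhds]
  intro ε hε
  set η := ε/2008 with hη
  have hη0 : 0 < η := by positivity
  have h1 := (J_lim.const_mul (η⁻¹^3))
  rw [mul_zero] at h1
  filter_upwards [h1.eventually (eventually_lt_nhds (show (0:ℝ) < ε/2 by positivity)), eventually_ge_atTop 1] with N hN hN1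
  have h0 : 0 ≤ ∫ v in Set.Ioi (0:ℝ), Real.sqrt v * |fN N v - chi v| :=
    setIntegral_nonneg measurableSet_Ioi fun v hv => by positivity
  rw [Real.dist_eq, sub_zero, abs_of_nonneg h0]
  have := (L1_bound N hN1 η hη0).2
  linarith

/-- radial integration in the plane -/
theorem radial (g : ℝ → ℝ) (a : ℝ) (ha : 0 < a) (hg : IntegrableOn (fun v => Real.sqrt v * g v) (Set.Ioi 0)) :
    Integrable (fun z : ℝ × ℝ => Real.sqrt (a * (z.1^2+z.2^2)) * g (a * (z.1^2+z.2^2))) ∧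
    ∃ c : ℝ, ∀ g : ℝ → ℝ, ∫ z : ℝ × ℝ, Real.sqrt (a * (z.1^2+z.2^2)) * g (a * (z.1^2+z.2^2)) =
      c * ∫ v in Set.Ioi (0:ℝ), Real.sqrt v * g v := by
  have key : ∀ (g : ℝ → ℝ) (z : ℂ), Real.sqrt (a * ((Complex.measurableEquivRealProd z).1^2+(Complex.measurableEquivRealProd z).2^2)) *
      g (a * ((Complex.measurableEquivRealProd z).1^2+(Complex.measurableEquivRealProd z).2^2)) =
      (fun r : ℝ => Real.sqrt (a * r^2) * g (a * r^2)) ‖z‖ := by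
    intro g z
    have : ‖z‖^2 = (Complex.measurableEquivRealProd z).1^2+(Complex.measurableEquivRealProd z).2^2 := by
      rw [Complex.sq_norm, Complex.normSq_apply]; simp [pow_two]
    simp only [this]
  have e1 : ∀ g : ℝ → ℝ, ∀ r ∈ Set.Ioi (0:ℝ), (r ^ (Module.finrank ℝ ℂ - 1)) • (fun r : ℝ => Real.sqrt (a * r^2) * g (a * r^2)) r
      = (1/2) * ((|(2:ℝ)| * r^((2:ℝ)-1)) • (fun s : ℝ => Real.sqrt (a * s) * g (a * s)) (r^(2:ℝ))) := by
    intro g r hr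
    rw [Complex.finrank_real_complex]
    norm_num
    ring
  constructor
  · rw [← Complex.volume_preserving_equiv_real_prod.integrable_comp_emb Complex.measurableEquivRealProd.measurableEmbedding]
    have : ((fun z : ℝ × ℝ => Real.sqrt (a * (z.1^2+z.2^2)) * g (a * (z.1^2+z.2^2))) ∘ Complex.measurableEquivRealProd)
      = fun z : ℂ => (fun r : ℝ => Real.sqrt (a * r^2) * g (a * r^2)) ‖z‖ := by
      ext z; exact key g z
    rw [this]
    refine (integrable_fun_norm_addHaar (μ := (volume : Measure ℂ))
      (f := fun r : ℝ => Real.sqrt (a * r^2) * g (a * r^2))).2 ?_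
    refine IntegrableOn.congr_fun ?_ (fun r hr => (e1 g r hr).symm) measurableSet_Ioi
    apply Integrable.const_mul
    apply (integrableOn_Ioi_comp_rpow_iff (fun s : ℝ => Real.sqrt (a * s) * g (a * s)) (p := 2) (by norm_num)).2
    exact (integrableOn_Ioi_comp_mul_left_iff (fun s : ℝ => Real.sqrt s * g s) 0 ha).2 (by simpa using hg)
  · refine ⟨2 * (volume : Measure ℂ).real (Metric.ball 0 1) * (1/2 * a⁻¹), fun g => ?_⟩
    rw [← Complex.volume_preserving_equiv_real_prod.integral_comp Complex.measurableEquivRealProd.measurableEmbedding]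
    simp only [key g]
    rw [integral_fun_norm_addHaar (μ := (volume : Measure ℂ)) (fun r : ℝ => Real.sqrt (a * r^2) * g (a * r^2)), setIntegral_congr_fun measurableSet_Ioi (e1 g), integral_const_mul,
      abs_of_pos (show (0:ℝ) < 2 by norm_num),
      integral_comp_rpow_Ioi_of_pos (g := fun s : ℝ => Real.sqrt (a * s) * g (a * s)) (by norm_num),
      integral_comp_mul_left_Ioi (fun s : ℝ => Real.sqrt s * g s) 0 ha, Complex.finrank_real_complex]
    simp only [smul_eq_mul, mul_zero, nsmul_eq_mul]
    push_cast; ring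

end PartF

/-- Weak convergence of the Weyl symbol of the Zeno Hamiltonian `H_N` to
`p·χ_D(x,p)`, tested against any function `φ` in the Lions–Paul class `𝒜`. -/
theorem weak_convergence_sigmaH (μ : ℝ) (hμ : 0 < μ) (φ : ℝ × ℝ → ℂ)
    (hφ_cont : Continuous φ)
    (hφ_zero : Tendsto φ (cocompact (ℝ × ℝ)) (nhds 0))
    (hφ_int : ∀ x : ℝ, Integrable (fun p : ℝ => φ (x, p)))
    (hφ_A : Integrable (fun y : ℝ =>
      ⨆ x : ℝ, ‖∫ p : ℝ, φ (x, p) * Complex.exp (-(Complex.I * (p:ℂ) * (y:ℂ)))‖)) :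
    Tendsto (fun N : ℕ =>
      ∫ z : ℝ × ℝ,
        (sigmaH (μ / N) N z.1 z.2 -
          (z.2 : ℂ) * (if z.1 ^ 2 + z.2 ^ 2 < 2 * μ then (1 : ℂ) else 0)) * φ z)
      atTop (nhds 0) := by
  -- `φ` is bounded
  obtain ⟨M, hM⟩ : ∃ M : ℝ, ∀ z, ‖φ z‖ ≤ M := by
    have h1 : ∀ᶠ z in cocompact (ℝ × ℝ), ‖φ z‖ < 1 := by
      have := hφ_zero.norm
      rw [norm_zero] at this
      exact this.eventually (eventually_lt_nhds zero_lt_one)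
    obtain ⟨K, hK, hKs⟩ := mem_cocompact.1 h1
    obtain ⟨M, hM⟩ := hK.exists_bound_of_continuousOn hφ_cont.continuousOn
    refine ⟨max M 1, fun z => ?_⟩
    by_cases hz : z ∈ K
    · exact (hM z hz).trans (le_max_left _ _)
    · exact (le_of_lt (hKs hz)).trans (le_max_right _ _)
  have ha : (0:ℝ) < 2/μ := by positivity
  obtain ⟨c, hc⟩ := (radial (fun v => |fN 1 v - chi v|) (2/μ) ha (L1_bound 1 le_rfl 1 one_pos).1).2
  have hs : 0 < Real.sqrt (2/μ) := Real.sqrt_pos.2 ha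
  set B := M * (Real.sqrt (2/μ))⁻¹ with hB
  have hlim := (L1_lim.const_mul c).const_mul B
  rw [mul_zero, mul_zero] at hlim
  refine squeeze_zero_norm' ?_ hlim
  filter_upwards [eventually_ge_atTop 1] with N hN
  have hN' : (0:ℝ) < N := by exact_mod_cast hN
  have hint := (radial (fun v => |fN N v - chi v|) (2/μ) ha (L1_bound N hN 1 one_pos).1).1
  rw [← hc (fun v => |fN N v - chi v|), ← integral_const_mul]
  refine norm_integral_le_of_norm_le (hint.const_mul B) (ae_of_all _ fun z => ?_)
  have e1 : sigmaH (μ/N) N z.1 z.2 = ((z.2 * fN N (2/μ * (z.1^2+z.2^2)) : ℝ) : ℂ) := by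
    rw [sigmaH_eq _ (by positivity)]
    congr 1
    rw [fN]
    have a1 : 2 * (z.1^2+z.2^2)/(μ/N) = N * (2/μ * (z.1^2+z.2^2)) := by field_simp
    have a2 : -((z.1^2+z.2^2)/(μ/N)) = -(N * (2/μ * (z.1^2+z.2^2)))/2 := by field_simp
    rw [a1, a2]; ring
  have e2 : (if z.1^2+z.2^2 < 2*μ then (1:ℂ) else 0) = ((chi (2/μ * (z.1^2+z.2^2)) : ℝ) : ℂ) := by
    have : z.1^2+z.2^2 < 2*μ ↔ 2/μ * (z.1^2+z.2^2) < 4 := by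
      rw [div_mul_eq_mul_div, div_lt_iff₀ hμ]
      constructor <;> intro h <;> linarith
    simp only [chi, this]
    split_ifs <;> simp
  rw [e1, e2]
  set v := 2/μ * (z.1^2+z.2^2) with hv
  rw [← Complex.ofReal_mul, ← Complex.ofReal_sub, ← mul_sub, norm_mul, Complex.norm_real, norm_mul,
    Real.norm_eq_abs, Real.norm_eq_abs]
  have e3 : |z.2| ≤ (Real.sqrt (2/μ))⁻¹ * Real.sqrt v := by
    rw [hv, Real.sqrt_mul ha.le, inv_mul_cancel_left₀ hs.ne']
    apply Real.abs_le_sqrt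
    nlinarith [sq_nonneg z.1]
  have hM0 : 0 ≤ M := (norm_nonneg _).trans (hM z)
  calc |z.2| * |fN N v - chi v| * ‖φ z‖ ≤ ((Real.sqrt (2/μ))⁻¹ * Real.sqrt v) * |fN N v - chi v| * M := by
        gcongr
        exact hM z
    _ = _ := by rw [hB]; ring
end
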